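/- (Theorem 2, asymptotic normality) Under conditions (C1) and (C2), if a_w/√N → 0 in probability and b_w/√N → ∞ in probability, then the active-coordinate block of the regularized maximum likelihood estimator is asymptotically normal: √N (θ̂_{N,A} − θ₀,A) converges in distribution, as n → ∞, to the centered multivariate Gaussian distribution on ℝ^{|A|} with covariance matrix I_A(θ₀)^{−1}, where I_A(θ₀) is the A×A submatrix of the limiting normalized Fisher information matrix I(θ₀). -/

import Mathlib

open Finset Real
open scoped Classical

noncomputable section

variable {E : Type*}

/-- Numeric 0/1 value of a Boolean edge indicator. -/
def bval (b : Bool) : ℝ := if b then 1 else 0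

/-- Ordered pairs `(j1, j2)` of nodes with `j1 < j2` (the dyads). -/
def pairsLT (n : ℕ) : Finset (Fin n × Fin n) := univ.filter fun q => q.1 < q.2

/-- Ordered pairs `(j1, j2)` of nodes with `j1 ≠ j2` (the potential directed edges). -/
def pairsNE (n : ℕ) : Finset (Fin n × Fin n) := univ.filter fun q => q.1 ≠ q.2

/-- The finite set of zero-diagonal binary adjacency matrices on `n` nodes. -/
def nets (n : ℕ) : Finset (Fin n → Fin n → Bool) :=
  univ.filter fun x => ∀ j, x j j = false

/-- The exponent `H_θ(x)` of the directed network model with nodal homophily and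
nodal effects, with parameter `θ = (θ1, θ2, γ, ζ, η)`. -/
def Hexp (n m : ℕ) (v : Fin n → Fin m → E) (w : E → E → ℝ) (g : E → ℝ)
    (θ1 θ2 : ℝ) (γ ζ η : Fin m → ℝ) (x : Fin n → Fin n → Bool) : ℝ :=
  θ1 * ∑ q ∈ pairsLT n, bval (x q.1 q.2) * bval (x q.2 q.1)
    + θ2 * ∑ q ∈ pairsNE n, bval (x q.1 q.2)
    + ∑ k, γ k * ∑ q ∈ pairsNE n, bval (x q.1 q.2) * w (v q.1 k) (v q.2 k)
    + ∑ k, ζ k * ∑ q ∈ pairsNE n, bval (x q.1 q.2) * g (v q.1 k)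
    + ∑ k, η k * ∑ q ∈ pairsNE n, bval (x q.1 q.2) * g (v q.2 k)

/-- The dyad weight `T_{ab}(j1, j2)`; note `T_{00}(j1,j2) = 1`. -/
def Tdyad (n m : ℕ) (v : Fin n → Fin m → E) (w : E → E → ℝ) (g : E → ℝ)
    (θ1 θ2 : ℝ) (γ ζ η : Fin m → ℝ) (j1 j2 : Fin n) (a b : Bool) : ℝ :=
  Real.exp (θ1 * (bval a * bval b)
    + (bval a + bval b) * (θ2 + ∑ k, γ k * w (v j1 k) (v j2 k))
    + ∑ k, ζ k * (bval a * g (v j1 k) + bval b * g (v j2 k))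
    + ∑ k, η k * (bval a * g (v j2 k) + bval b * g (v j1 k)))

/-- The normalizing constant `z(θ)` of the directed network model. -/
def zconst (n m : ℕ) (v : Fin n → Fin m → E) (w : E → E → ℝ) (g : E → ℝ)
    (θ1 θ2 : ℝ) (γ ζ η : Fin m → ℝ) : ℝ :=
  ∑ x ∈ nets n, Real.exp (Hexp n m v w g θ1 θ2 γ ζ η x)

/-- The probability mass function `P_θ(X = x) = exp H_θ(x) / z(θ)`. -/
def Pnet (n m : ℕ) (v : Fin n → Fin m → E) (w : E → E → ℝ) (g : E → ℝ)
    (θ1 θ2 : ℝ) (γ ζ η : Fin m → ℝ) (x : Fin n → Fin n → Bool) : ℝ :=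
  Real.exp (Hexp n m v w g θ1 θ2 γ ζ η x) / zconst n m v w g θ1 θ2 γ ζ η

/-- The marginal probability `P_θ(X_{j1j2} = a, X_{j2j1} = b)` of a dyad. -/
def Pdyad (n m : ℕ) (v : Fin n → Fin m → E) (w : E → E → ℝ) (g : E → ℝ)
    (θ1 θ2 : ℝ) (γ ζ η : Fin m → ℝ) (j1 j2 : Fin n) (a b : Bool) : ℝ :=
  ∑ x ∈ (nets n).filter (fun x => x j1 j2 = a ∧ x j2 j1 = b),
    Pnet n m v w g θ1 θ2 γ ζ η x

/-- The marginal probability `P_θ(X_{j1j2} = a)` of a single directed edge indicator. -/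
def Pedge (n m : ℕ) (v : Fin n → Fin m → E) (w : E → E → ℝ) (g : E → ℝ)
    (θ1 θ2 : ℝ) (γ ζ η : Fin m → ℝ) (j1 j2 : Fin n) (a : Bool) : ℝ :=
  ∑ x ∈ (nets n).filter (fun x => x j1 j2 = a), Pnet n m v w g θ1 θ2 γ ζ η x

/-- Index type for the parameter space `ℝ^p` with `p = 3m + 2`: two global parameters
`(θ1, θ2)`, the homophily block, the out-edge block and the in-edge block. -/
abbrev Idx (m : ℕ) := Fin 2 ⊕ (Fin m ⊕ (Fin m ⊕ Fin m))

/-- The vector of sufficient statistics `s(x) ∈ ℝ^p`: the coefficient of each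
coordinate of `θ` in `H_θ(x)`. -/
def svec (n m : ℕ) (v : Fin n → Fin m → E) (w : E → E → ℝ) (g : E → ℝ)
    (x : Fin n → Fin n → Bool) : Idx m → ℝ
  | Sum.inl i =>
      if i = 0 then ∑ q ∈ pairsLT n, bval (x q.1 q.2) * bval (x q.2 q.1)
      else ∑ q ∈ pairsNE n, bval (x q.1 q.2)
  | Sum.inr (Sum.inl k) => ∑ q ∈ pairsNE n, bval (x q.1 q.2) * w (v q.1 k) (v q.2 k)
  | Sum.inr (Sum.inr (Sum.inl k)) => ∑ q ∈ pairsNE n, bval (x q.1 q.2) * g (v q.1 k)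
  | Sum.inr (Sum.inr (Sum.inr k)) => ∑ q ∈ pairsNE n, bval (x q.1 q.2) * g (v q.2 k)

/-- The exponent of the model written as `H_θ(x) = θᵀ s(x)`. -/
def Hvec (n m : ℕ) (v : Fin n → Fin m → E) (w : E → E → ℝ) (g : E → ℝ)
    (θ : Idx m → ℝ) (x : Fin n → Fin n → Bool) : ℝ :=
  ∑ i, θ i * svec n m v w g x i

/-- The normalizing constant (partition function) `z(θ)`. -/
def Zvec (n m : ℕ) (v : Fin n → Fin m → E) (w : E → E → ℝ) (g : E → ℝ)
    (θ : Idx m → ℝ) : ℝ :=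
  ∑ x ∈ nets n, Real.exp (Hvec n m v w g θ x)

/-- The probability mass function `P_θ(X = x) = exp H_θ(x)/z(θ)`. -/
def Pvec (n m : ℕ) (v : Fin n → Fin m → E) (w : E → E → ℝ) (g : E → ℝ)
    (θ : Idx m → ℝ) (x : Fin n → Fin n → Bool) : ℝ :=
  Real.exp (Hvec n m v w g θ x) / Zvec n m v w g θ

/-- Expectation of a real statistic under `P_θ`. -/
def Emean (n m : ℕ) (v : Fin n → Fin m → E) (w : E → E → ℝ) (g : E → ℝ)
    (θ : Idx m → ℝ) (f : (Fin n → Fin n → Bool) → ℝ) : ℝ :=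
  ∑ x ∈ nets n, f x * Pvec n m v w g θ x

/-- The number of dyads `N = n(n−1)/2`. -/
def Ndyads (n : ℕ) : ℕ := n * (n - 1) / 2

/-- The Euclidean norm on `ℝ^p`. -/
def enorm {m : ℕ} (u : Idx m → ℝ) : ℝ := Real.sqrt (∑ i, u i ^ 2)

/-- The log-likelihood `L_N(θ) = H_θ(x) − log z(θ)` at the observed network `x`. -/
def Llik (n m : ℕ) (v : Fin n → Fin m → E) (w : E → E → ℝ) (g : E → ℝ)
    (θ : Idx m → ℝ) (x : Fin n → Fin n → Bool) : ℝ :=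
  Hvec n m v w g θ x - Real.log (Zvec n m v w g θ)

/-- Probability, under `P_{θ0}`, of the event `φ` (a set of zero-diagonal networks). -/
def Pr (n m : ℕ) (v : Fin n → Fin m → E) (w : E → E → ℝ) (g : E → ℝ)
    (θ0 : Idx m → ℝ) (φ : (Fin n → Fin n → Bool) → Prop) : ℝ :=
  ∑ x ∈ (nets n).filter (fun x => φ x), Pvec n m v w g θ0 x

/-- The Fisher information matrix `I_N(θ0) = Cov_{θ0}(∇_θ L_N(θ0))`.  Since the score
is `∇_θ L_N(θ0) = s(X) − E_{θ0}[s(X)]`, this is the covariance matrix of the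
sufficient statistic `s(X)` under `P_{θ0}`. -/
def Ifish (n m : ℕ) (v : Fin n → Fin m → E) (w : E → E → ℝ) (g : E → ℝ)
    (θ0 : Idx m → ℝ) : Matrix (Idx m) (Idx m) ℝ :=
  Matrix.of fun k l =>
    Emean n m v w g θ0 (fun x => svec n m v w g x k * svec n m v w g x l)
      - Emean n m v w g θ0 (fun x => svec n m v w g x k)
          * Emean n m v w g θ0 (fun x => svec n m v w g x l)

/-- Condition (C1): the dyad covariate vectors `S_{j1j2}` (whose entries are `1`, `2`,
`w(v_{j1k}, v_{j2k})`, `g(v_{j1k})` and `g(v_{j2k})`) are uniformly bounded over `n`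
and over dyads, and `θ0` lies in the interior of a compact convex set `Θ ⊂ ℝ^p`. -/
def CondC1 {E : Type*} (m : ℕ) (v : (n : ℕ) → Fin n → Fin m → E)
    (w : E → E → ℝ) (g : E → ℝ) (θ0 : Idx m → ℝ) (Θ : Set (Idx m → ℝ)) : Prop :=
  (∃ B : ℝ, ∀ (n : ℕ) (j1 j2 : Fin n) (k : Fin m),
      |w (v n j1 k) (v n j2 k)| ≤ B ∧ |g (v n j1 k)| ≤ B)
    ∧ IsCompact Θ ∧ Convex ℝ Θ ∧ θ0 ∈ interior Θ

/-- Condition (C2): `N⁻¹ I_N(θ0)` converges, as `n → ∞`, to a positive definite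
matrix `I(θ0)`. -/
def CondC2 {E : Type*} (m : ℕ) (v : (n : ℕ) → Fin n → Fin m → E)
    (w : E → E → ℝ) (g : E → ℝ) (θ0 : Idx m → ℝ)
    (Imat : Matrix (Idx m) (Idx m) ℝ) : Prop :=
  Filter.Tendsto (fun n : ℕ => ((Ndyads n : ℝ))⁻¹ • Ifish n m (v n) w g θ0)
      Filter.atTop (nhds Imat)
    ∧ Imat.PosDef

open MeasureTheory in
/-- The centered Gaussian measure on `ℝ^A` (`A` a finite index type) with covariance
matrix `Σ⁻¹`, specified through its Lebesgue density
`u ↦ (2π)^{−d/2} √(det Σ) exp(−uᵀ Σ u / 2)`, where `Σ` is the precision matrix. -/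
def gaussPrec {A : Type*} [Fintype A] (Sig : Matrix A A ℝ) : Measure (A → ℝ) :=
  volume.withDensity fun u =>
    ENNReal.ofReal ((2 * Real.pi) ^ (-(Fintype.card A : ℝ) / 2)
      * Real.sqrt Sig.det * Real.exp (-(∑ k, ∑ l, u k * Sig k l * u l) / 2))

/-- The pair of edge indicators of a network at a dyad. -/
def dyadState {n : ℕ} (x : Fin n → Fin n → Bool) (q : Fin n × Fin n) : Bool × Bool :=
  (x q.1 q.2, x q.2 q.1)

/-- The contribution of a dyad to the sufficient statistic. -/
def dyadStat (n m : ℕ) (v : Fin n → Fin m → E) (w : E → E → ℝ) (g : E → ℝ)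
    (q : Fin n × Fin n) (c : Bool × Bool) : Idx m → ℝ
  | Sum.inl i => if i = 0 then bval c.1 * bval c.2 else bval c.1 + bval c.2
  | Sum.inr (Sum.inl k) =>
      bval c.1 * w (v q.1 k) (v q.2 k) + bval c.2 * w (v q.2 k) (v q.1 k)
  | Sum.inr (Sum.inr (Sum.inl k)) => bval c.1 * g (v q.1 k) + bval c.2 * g (v q.2 k)
  | Sum.inr (Sum.inr (Sum.inr k)) => bval c.1 * g (v q.2 k) + bval c.2 * g (v q.1 k)

theorem sum_pairsNE_eq (n : ℕ) (f : Fin n × Fin n → ℝ) :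
    ∑ q ∈ pairsNE n, f q = ∑ q ∈ pairsLT n, (f q + f q.swap) := by
  have hsplit : pairsNE n = pairsLT n ∪ (pairsLT n).image Prod.swap := by
    ext ⟨a, b⟩
    simp only [pairsNE, pairsLT, mem_filter, mem_univ, true_and, mem_union, mem_image,
      Prod.exists, Prod.swap_prod_mk, Prod.mk.injEq]
    constructor
    · intro h
      rcases lt_or_gt_of_ne h with h | h
      · exact Or.inl h
      · exact Or.inr ⟨b, a, h, rfl, rfl⟩
    · rintro (h | ⟨c, d, h, rfl, rfl⟩)
      · exact h.ne
      · exact h.ne'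
  have hdisj : Disjoint (pairsLT n) ((pairsLT n).image Prod.swap) := by
    rw [Finset.disjoint_left]
    rintro ⟨a, b⟩ h
    simp only [pairsLT, mem_filter, mem_univ, true_and, mem_image,
      Prod.exists, Prod.swap_prod_mk, Prod.mk.injEq] at h ⊢
    rintro ⟨c, d, h', rfl, rfl⟩
    exact absurd h h'.not_gt
  rw [hsplit, sum_union hdisj, sum_image (fun _ _ _ _ h => Prod.swap_injective h),
    sum_add_distrib]

theorem svec_eq_sum_dyadStat (n m : ℕ) (v : Fin n → Fin m → E) (w : E → E → ℝ) (g : E → ℝ)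
    (x : Fin n → Fin n → Bool) (i : Idx m) :
    svec n m v w g x i = ∑ q ∈ pairsLT n, dyadStat n m v w g q (dyadState x q) i := by
  rcases i with i | k | k | k
  · by_cases h : i = 0
    · simp [svec, dyadStat, dyadState, h]
    · simp [svec, dyadStat, dyadState, h, sum_pairsNE_eq]
  all_goals simp [svec, dyadStat, dyadState, sum_pairsNE_eq]

/-- Sums over networks of dyadwise products factor over dyads. -/
theorem sum_nets_prod {R : Type*} [CommSemiring R] (n : ℕ)
    (F : Fin n × Fin n → Bool × Bool → R) :
    ∑ x ∈ nets n, ∏ q ∈ pairsLT n, F q (dyadState x q) = ∏ q ∈ pairsLT n, ∑ c, F q c := by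
  rw [← Finset.prod_coe_sort (pairsLT n) (fun q => ∑ c, F q c), Finset.prod_univ_sum]
  refine Finset.sum_bij' (fun x _ => fun q => dyadState x q.1)
    (fun y _ => fun a b =>
      if h : a < b then (y ⟨(a, b), by simpa [pairsLT] using h⟩).1
      else if h : b < a then (y ⟨(b, a), by simpa [pairsLT] using h⟩).2 else false)
    ?_ ?_ ?_ ?_ ?_
  · intro x _
    simp
  · intro y _
    simp [nets]
  · intro x hx
    simp only [nets, mem_filter, mem_univ, true_and] at hx
    funext a b
    rcases lt_trichotomy a b with h | h | h
    · simp [h, dyadState]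
    · subst h; simp [hx]
    · simp [h, h.not_gt, dyadState]
  · intro y _
    funext q
    obtain ⟨⟨a, b⟩, hq⟩ := q
    have h : a < b := by simpa [pairsLT] using hq
    simp [dyadState, h, h.not_gt]
  · intro x _
    rw [← Finset.prod_coe_sort (pairsLT n) (fun q => F q (dyadState x q))]

section DyadProduct

variable {n : ℕ} {p Y : Fin n × Fin n → Bool × Bool → ℝ}

theorem sum_nets_prod_mul_single {q : Fin n × Fin n} (hq : q ∈ pairsLT n)
    (f : Bool × Bool → ℝ) (hp : ∀ q ∈ pairsLT n, ∑ c, p q c = 1) :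
    ∑ x ∈ nets n, (∏ r ∈ pairsLT n, p r (dyadState x r)) * f (dyadState x q)
      = ∑ c, p q c * f c := by
  have h := sum_nets_prod n (fun r c => p r c * if r = q then f c else 1)
  simp only [Finset.prod_mul_distrib] at h
  rw [Finset.prod_eq_single_of_mem q hq] at h
  · simp only [if_true] at h
    rw [← h]
    refine Finset.sum_congr rfl fun x _ => ?_
    congr 1
    rw [Finset.prod_ite_eq' (pairsLT n) q (fun r => f (dyadState x r)), if_pos hq]
  · intro r hr hrq
    simp [hrq, hp r hr]

theorem sum_nets_prod_mul_pair {q r : Fin n × Fin n} (hq : q ∈ pairsLT n) (hr : r ∈ pairsLT n)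
    (hqr : q ≠ r) (f f' : Bool × Bool → ℝ) (hf : ∑ c, p q c * f c = 0) :
    ∑ x ∈ nets n, (∏ r ∈ pairsLT n, p r (dyadState x r)) * (f (dyadState x q) * f' (dyadState x r))
      = 0 := by
  have h := sum_nets_prod n
    (fun s c => p s c * ((if s = q then f c else 1) * (if s = r then f' c else 1)))
  simp only [Finset.prod_mul_distrib] at h
  rw [Finset.prod_eq_zero hq (by simpa [hqr] using hf)] at h
  rw [← h]
  refine Finset.sum_congr rfl fun x _ => ?_
  congr 1
  rw [Finset.prod_ite_eq' (pairsLT n) q (fun r => f (dyadState x r)), if_pos hq,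
    Finset.prod_ite_eq' (pairsLT n) r (fun r => f' (dyadState x r)), if_pos hr]

theorem sum_nets_prod_mul_sum (hp : ∀ q ∈ pairsLT n, ∑ c, p q c = 1)
    (hY : ∀ q ∈ pairsLT n, ∑ c, p q c * Y q c = 0) :
    ∑ x ∈ nets n, (∏ r ∈ pairsLT n, p r (dyadState x r)) * ∑ q ∈ pairsLT n, Y q (dyadState x q)
      = 0 := by
  simp only [Finset.mul_sum]
  rw [Finset.sum_comm]
  refine Finset.sum_eq_zero fun q hq => ?_
  rw [sum_nets_prod_mul_single hq (Y q) hp, hY q hq]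

theorem sum_nets_prod_mul_sum_sq (hp : ∀ q ∈ pairsLT n, ∑ c, p q c = 1)
    (hY : ∀ q ∈ pairsLT n, ∑ c, p q c * Y q c = 0) :
    ∑ x ∈ nets n, (∏ r ∈ pairsLT n, p r (dyadState x r))
        * (∑ q ∈ pairsLT n, Y q (dyadState x q)) ^ 2
      = ∑ q ∈ pairsLT n, ∑ c, p q c * Y q c ^ 2 := by
  simp only [sq, Finset.sum_mul_sum]
  simp only [Finset.mul_sum]
  rw [Finset.sum_comm]
  refine Finset.sum_congr rfl fun q hq => ?_
  rw [Finset.sum_comm, Finset.sum_eq_single_of_mem q hq]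
  · exact sum_nets_prod_mul_single hq (fun c => Y q c * Y q c) hp
  · intro r hr hrq
    exact sum_nets_prod_mul_pair hq hr hrq.symm _ _ (hY q hq)

end DyadProduct

theorem exists_log_charfun_approx {α : Type*} [Fintype α] {p Y : α → ℝ} (hp0 : ∀ a, 0 ≤ p a)
    (hp1 : ∑ a, p a = 1) (hY : ∑ a, p a * Y a = 0) {δ : ℝ} (hδ0 : 0 ≤ δ) (hδ : δ ≤ 1 / 4)
    (hYδ : ∀ a, |Y a| ≤ δ) {ζ : ℂ} (hζ : ‖ζ‖ ≤ 1) :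
    ∃ c : ℂ, ∑ a, (p a : ℂ) * Complex.exp (ζ * Y a) = Complex.exp c ∧
      ‖c - ζ ^ 2 / 2 * ((∑ a, p a * Y a ^ 2 : ℝ) : ℂ)‖ ≤ 4 * δ ^ 3 := by
  set y : ℂ := ∑ a, (p a : ℂ) * Complex.exp (ζ * Y a) - 1 with hy
  have hp1' : ∑ a, (p a : ℂ) = 1 := by exact_mod_cast hp1
  have hY' : ∑ a, (p a : ℂ) * (Y a : ℂ) = 0 := by exact_mod_cast hY
  have hz : ∀ a, ‖ζ * (Y a : ℂ)‖ ≤ δ := fun a => by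
    rw [norm_mul, Complex.norm_real, Real.norm_eq_abs]
    calc ‖ζ‖ * |Y a| ≤ 1 * δ := mul_le_mul hζ (hYδ a) (abs_nonneg _) zero_le_one
      _ = δ := one_mul δ
  have hexp : ∀ a, ‖Complex.exp (ζ * Y a) - (1 + ζ * Y a + (ζ * Y a) ^ 2 / 2)‖ ≤ δ ^ 3 := fun a => by
    have h := Complex.exp_bound ((hz a).trans (by linarith)) (n := 3) (by norm_num)
    simp only [Finset.sum_range_succ, Finset.sum_range_zero, Nat.factorial, Nat.succ_eq_add_one] at h
    norm_num at h
    refine h.trans ?_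
    have h3 : (‖ζ‖ * |Y a|) ^ 3 ≤ δ ^ 3 := by
      have := hz a
      rw [norm_mul, Complex.norm_real, Real.norm_eq_abs] at this
      exact pow_le_pow_left₀ (by positivity) this 3
    have h0 : 0 ≤ (‖ζ‖ * |Y a|) ^ 3 := by positivity
    linarith
  have hyσ : ‖y - ζ ^ 2 / 2 * ((∑ a, p a * Y a ^ 2 : ℝ) : ℂ)‖ ≤ δ ^ 3 := by
    have heq : y - ζ ^ 2 / 2 * ((∑ a, p a * Y a ^ 2 : ℝ) : ℂ)
        = ∑ a, (p a : ℂ) * (Complex.exp (ζ * Y a) - (1 + ζ * Y a + (ζ * Y a) ^ 2 / 2)) := by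
      have e1 : ∑ a, (p a : ℂ) * (ζ * Y a) = 0 := by
        rw [← mul_zero ζ, ← hY', Finset.mul_sum]
        exact Finset.sum_congr rfl fun a _ => by ring
      have e2 : ∑ a, (p a : ℂ) * ((ζ * Y a) ^ 2 / 2)
          = ζ ^ 2 / 2 * ((∑ a, p a * Y a ^ 2 : ℝ) : ℂ) := by
        push_cast
        rw [Finset.mul_sum]
        exact Finset.sum_congr rfl fun a _ => by ring
      simp only [mul_sub, mul_add, Finset.sum_sub_distrib, Finset.sum_add_distrib, mul_one, hp1',
        e1, e2, hy]
      ring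
    rw [heq]
    calc ‖_‖ ≤ ∑ a, ‖(p a : ℂ) * (Complex.exp (ζ * Y a) - (1 + ζ * Y a + (ζ * Y a) ^ 2 / 2))‖ :=
          norm_sum_le _ _
      _ ≤ ∑ a, p a * δ ^ 3 := Finset.sum_le_sum fun a _ => by
          rw [norm_mul, Complex.norm_real, Real.norm_of_nonneg (hp0 a)]
          exact mul_le_mul_of_nonneg_left (hexp a) (hp0 a)
      _ = δ ^ 3 := by rw [← Finset.sum_mul, hp1, one_mul]
  have hσ : ‖ζ ^ 2 / 2 * ((∑ a, p a * Y a ^ 2 : ℝ) : ℂ)‖ ≤ δ ^ 2 / 2 := by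
    have h0 : 0 ≤ ∑ a, p a * Y a ^ 2 :=
      Finset.sum_nonneg fun a _ => mul_nonneg (hp0 a) (sq_nonneg _)
    have h1 : ∑ a, p a * Y a ^ 2 ≤ δ ^ 2 := by
      calc ∑ a, p a * Y a ^ 2 ≤ ∑ a, p a * δ ^ 2 := Finset.sum_le_sum fun a _ =>
            mul_le_mul_of_nonneg_left (sq_le_sq' (neg_le_of_abs_le (hYδ a)) (le_of_abs_le (hYδ a)))
              (hp0 a)
        _ = δ ^ 2 := by rw [← Finset.sum_mul, hp1, one_mul]
    rw [norm_mul, norm_div, norm_pow, Complex.norm_real, Real.norm_of_nonneg h0, Complex.norm_ofNat]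
    have h2 : ‖ζ‖ ^ 2 ≤ 1 := pow_le_one₀ (norm_nonneg _) hζ
    nlinarith [norm_nonneg ζ]
  have hδ32 : δ ^ 3 ≤ δ ^ 2 / 4 := by nlinarith [sq_nonneg δ]
  have hyn : ‖y‖ ≤ δ ^ 2 := by
    have := norm_add_le (y - ζ ^ 2 / 2 * ((∑ a, p a * Y a ^ 2 : ℝ) : ℂ))
      (ζ ^ 2 / 2 * ((∑ a, p a * Y a ^ 2 : ℝ) : ℂ))
    rw [sub_add_cancel] at this
    nlinarith [sq_nonneg δ]
  have hy16 : ‖y‖ ≤ 1 / 16 := hyn.trans (by nlinarith)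
  refine ⟨Complex.log (1 + y), ?_, ?_⟩
  · rw [Complex.exp_log]
    · rw [hy]; ring
    · intro h0
      have : y = -1 := by linear_combination h0
      rw [this] at hy16
      norm_num at hy16
  · have hlog := Complex.norm_log_one_add_sub_self_le (z := y) (by linarith)
    have hinv : (1 - ‖y‖)⁻¹ ≤ 2 := by
      rw [inv_le_comm₀ (by linarith) (by norm_num)]
      linarith
    have hlog' : ‖Complex.log (1 + y) - y‖ ≤ δ ^ 3 := by
      refine hlog.trans ?_
      have h1 : ‖y‖ ^ 2 ≤ (δ ^ 2) ^ 2 := pow_le_pow_left₀ (norm_nonneg _) hyn 2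
      have h2 : (δ ^ 2) ^ 2 ≤ δ ^ 3 := by nlinarith [pow_nonneg hδ0 3]
      have h3 : ‖y‖ ^ 2 * (1 - ‖y‖)⁻¹ ≤ ‖y‖ ^ 2 * 2 :=
        mul_le_mul_of_nonneg_left hinv (sq_nonneg _)
      linarith
    have := norm_add_le (Complex.log (1 + y) - y)
      (y - ζ ^ 2 / 2 * ((∑ a, p a * Y a ^ 2 : ℝ) : ℂ))
    rw [sub_add_sub_cancel] at this
    have h0 : 0 ≤ δ ^ 3 := by positivity
    linarith

theorem exists_log_charfun_nets_approx {n : ℕ} {p Y : Fin n × Fin n → Bool × Bool → ℝ}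
    (hp0 : ∀ q c, 0 ≤ p q c) (hp1 : ∀ q ∈ pairsLT n, ∑ c, p q c = 1)
    (hY : ∀ q ∈ pairsLT n, ∑ c, p q c * Y q c = 0) {δ : ℝ} (hδ0 : 0 ≤ δ) (hδ : δ ≤ 1 / 4)
    (hYδ : ∀ q ∈ pairsLT n, ∀ c, |Y q c| ≤ δ) {ζ : ℂ} (hζ : ‖ζ‖ ≤ 1) :
    ∃ c : ℂ, ∑ x ∈ nets n, ((∏ q ∈ pairsLT n, p q (dyadState x q) : ℝ) : ℂ)
        * Complex.exp (ζ * ((∑ q ∈ pairsLT n, Y q (dyadState x q) : ℝ) : ℂ)) = Complex.exp c ∧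
      ‖c - ζ ^ 2 / 2 * ((∑ q ∈ pairsLT n, ∑ a, p q a * Y q a ^ 2 : ℝ) : ℂ)‖
        ≤ (pairsLT n).card * (4 * δ ^ 3) := by
  choose! c hc hcb using fun q (hq : q ∈ pairsLT n) =>
    exists_log_charfun_approx (hp0 q) (hp1 q hq) (hY q hq) hδ0 hδ (hYδ q hq) hζ
  refine ⟨∑ q ∈ pairsLT n, c q, ?_, ?_⟩
  · rw [Complex.exp_sum, ← Finset.prod_congr rfl hc,
      ← sum_nets_prod n (fun q a => (p q a : ℂ) * Complex.exp (ζ * Y q a))]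
    refine Finset.sum_congr rfl fun x _ => ?_
    push_cast
    rw [Finset.prod_mul_distrib, Finset.mul_sum, Complex.exp_sum]
  · push_cast
    rw [Finset.mul_sum, ← Finset.sum_sub_distrib, ← nsmul_eq_mul]
    refine (norm_sum_le _ _).trans (Finset.sum_le_card_nsmul _ _ _ fun q hq => ?_)
    have := hcb q hq
    push_cast at this
    exact this

section Model

variable (n m : ℕ) (v : Fin n → Fin m → E) (w : E → E → ℝ) (g : E → ℝ) (θ : Idx m → ℝ)

/-- The dyad distribution of the model. -/
def dyadProb (q : Fin n × Fin n) (c : Bool × Bool) : ℝ :=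
  Real.exp (∑ i, θ i * dyadStat n m v w g q c i)
    / ∑ c', Real.exp (∑ i, θ i * dyadStat n m v w g q c' i)

theorem dyadProb_nonneg (q : Fin n × Fin n) (c : Bool × Bool) : 0 ≤ dyadProb n m v w g θ q c := by
  unfold dyadProb; positivity

theorem sum_dyadProb (q : Fin n × Fin n) : ∑ c, dyadProb n m v w g θ q c = 1 := by
  unfold dyadProb
  rw [← Finset.sum_div]
  exact div_self (Finset.sum_pos (fun _ _ => Real.exp_pos _) ⟨(true, true), mem_univ _⟩).ne'

theorem sum_mul_svec (h : Idx m → ℝ) (x : Fin n → Fin n → Bool) :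
    ∑ i, h i * svec n m v w g x i
      = ∑ q ∈ pairsLT n, ∑ i, h i * dyadStat n m v w g q (dyadState x q) i := by
  simp only [svec_eq_sum_dyadStat, Finset.mul_sum]
  exact Finset.sum_comm

theorem exp_Hvec (x : Fin n → Fin n → Bool) :
    Real.exp (Hvec n m v w g θ x)
      = ∏ q ∈ pairsLT n, Real.exp (∑ i, θ i * dyadStat n m v w g q (dyadState x q) i) := by
  rw [Hvec, sum_mul_svec, Real.exp_sum]

theorem Pvec_eq_prod (x : Fin n → Fin n → Bool) :
    Pvec n m v w g θ x = ∏ q ∈ pairsLT n, dyadProb n m v w g θ q (dyadState x q) := by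
  unfold Pvec Zvec dyadProb
  simp only [exp_Hvec]
  rw [sum_nets_prod n (fun q c => Real.exp (∑ i, θ i * dyadStat n m v w g q c i)),
    Finset.prod_div_distrib]

theorem Zvec_pos : 0 < Zvec n m v w g θ :=
  Finset.sum_pos (fun _ _ => Real.exp_pos _) ⟨fun _ _ => false, by simp [nets]⟩

theorem Pvec_nonneg (x : Fin n → Fin n → Bool) : 0 ≤ Pvec n m v w g θ x :=
  div_nonneg (Real.exp_pos _).le (Zvec_pos n m v w g θ).le

theorem sum_Pvec : ∑ x ∈ nets n, Pvec n m v w g θ x = 1 := by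
  unfold Pvec
  rw [← Finset.sum_div]
  exact div_self (Zvec_pos n m v w g θ).ne'

/-- The linear form `h` evaluated at the centred sufficient statistic. -/
def centredStat (h : Idx m → ℝ) (x : Fin n → Fin n → Bool) : ℝ :=
  ∑ k, h k * (svec n m v w g x k - Emean n m v w g θ fun y => svec n m v w g y k)

/-- The linear form `h` evaluated at the centred contribution of a dyad. -/
def centredDyad (h : Idx m → ℝ) (q : Fin n × Fin n) (c : Bool × Bool) : ℝ :=
  ∑ i, h i * dyadStat n m v w g q c i
    - ∑ c', dyadProb n m v w g θ q c' * ∑ i, h i * dyadStat n m v w g q c' i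

theorem sum_dyadProb_mul_centredDyad (h : Idx m → ℝ) (q : Fin n × Fin n) :
    ∑ c, dyadProb n m v w g θ q c * centredDyad n m v w g θ h q c = 0 := by
  unfold centredDyad
  simp only [mul_sub, Finset.sum_sub_distrib]
  rw [← Finset.sum_mul, sum_dyadProb, one_mul, sub_self]

theorem centredStat_eq_sum (h : Idx m → ℝ) (x : Fin n → Fin n → Bool) :
    centredStat n m v w g θ h x
      = ∑ q ∈ pairsLT n, centredDyad n m v w g θ h q (dyadState x q) := by
  set M : ℝ := ∑ q ∈ pairsLT n,
    ∑ c', dyadProb n m v w g θ q c' * ∑ i, h i * dyadStat n m v w g q c' i with hM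
  have hx : ∀ y, ∑ q ∈ pairsLT n, centredDyad n m v w g θ h q (dyadState y q)
      = ∑ i, h i * svec n m v w g y i - M := fun y => by
    unfold centredDyad
    rw [Finset.sum_sub_distrib, sum_mul_svec]
  have h0 := sum_nets_prod_mul_sum (fun q _ => sum_dyadProb n m v w g θ q)
    (fun q _ => sum_dyadProb_mul_centredDyad n m v w g θ h q)
  simp only [hx, ← Pvec_eq_prod, mul_sub, Finset.sum_sub_distrib] at h0
  rw [← Finset.sum_mul, sum_Pvec, one_mul, sub_eq_zero] at h0
  rw [hx, ← h0]
  simp only [centredStat, mul_sub, Finset.sum_sub_distrib, Emean, Finset.mul_sum]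
  congr 1
  rw [Finset.sum_comm]
  exact Finset.sum_congr rfl fun y _ => Finset.sum_congr rfl fun i _ => by ring

theorem Emean_centred_mul (k l : Idx m) :
    Emean n m v w g θ (fun x =>
      (svec n m v w g x k - Emean n m v w g θ fun y => svec n m v w g y k)
      * (svec n m v w g x l - Emean n m v w g θ fun y => svec n m v w g y l))
      = Ifish n m v w g θ k l := by
  simp only [Ifish, Matrix.of_apply]
  set a := Emean n m v w g θ fun y => svec n m v w g y k with ha
  set b := Emean n m v w g θ fun y => svec n m v w g y l with hb
  have h : ∀ x, (svec n m v w g x k - a) * (svec n m v w g x l - b) * Pvec n m v w g θ x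
      = svec n m v w g x k * svec n m v w g x l * Pvec n m v w g θ x
        - b * (svec n m v w g x k * Pvec n m v w g θ x)
        - a * (svec n m v w g x l * Pvec n m v w g θ x) + a * b * Pvec n m v w g θ x :=
    fun x => by ring
  rw [Emean]
  simp only [h, Finset.sum_add_distrib, Finset.sum_sub_distrib, ← Finset.mul_sum, sum_Pvec]
  change _ - b * a - a * b + a * b * 1 = _
  simp only [Emean]
  ring

theorem Emean_centredStat_sq (h : Idx m → ℝ) :
    Emean n m v w g θ (fun x => centredStat n m v w g θ h x ^ 2)
      = ∑ k, ∑ l, h k * Ifish n m v w g θ k l * h l := by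
  simp only [← Emean_centred_mul, centredStat, sq, Finset.sum_mul_sum]
  simp only [Emean, Finset.sum_mul, Finset.mul_sum]
  rw [Finset.sum_comm]
  refine Finset.sum_congr rfl fun k _ => ?_
  rw [Finset.sum_comm]
  exact Finset.sum_congr rfl fun l _ => Finset.sum_congr rfl fun x _ => by ring

theorem sum_variance_centredDyad (h : Idx m → ℝ) :
    ∑ q ∈ pairsLT n, ∑ c, dyadProb n m v w g θ q c * centredDyad n m v w g θ h q c ^ 2
      = ∑ k, ∑ l, h k * Ifish n m v w g θ k l * h l := by
  rw [← Emean_centredStat_sq, ← sum_nets_prod_mul_sum_sq (fun q _ => sum_dyadProb n m v w g θ q)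
    (fun q _ => sum_dyadProb_mul_centredDyad n m v w g θ h q), Emean]
  refine Finset.sum_congr rfl fun x _ => ?_
  rw [← Pvec_eq_prod, ← centredStat_eq_sum, mul_comm]

theorem abs_sum_mul_le_card_mul {ι : Type*} [Fintype ι] (h : ι → ℝ) {f : ι → ℝ} {B : ℝ}
    (hf : ∀ i, |f i| ≤ B) : |∑ i, h i * f i| ≤ Fintype.card ι * (‖h‖ * B) := by
  refine (Finset.abs_sum_le_sum_abs _ _).trans ?_
  rw [← nsmul_eq_mul]
  refine Finset.sum_le_card_nsmul _ _ _ fun i _ => ?_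
  rw [abs_mul]
  exact mul_le_mul (norm_le_pi_norm h i) (hf i) (abs_nonneg _) (norm_nonneg _)

variable {n m v w g} in
theorem abs_dyadStat_le {B : ℝ} (hB : ∀ (j1 j2 : Fin n) (k : Fin m),
    |w (v j1 k) (v j2 k)| ≤ B ∧ |g (v j1 k)| ≤ B) (q : Fin n × Fin n) (c : Bool × Bool)
    (i : Idx m) : |dyadStat n m v w g q c i| ≤ 2 * (1 + |B|) := by
  have hb : ∀ b : Bool, |bval b| ≤ 1 := fun b => by cases b <;> simp [bval]
  have hB' : B ≤ 1 + |B| := by linarith [le_abs_self B]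
  have key : ∀ (b b' : Bool) (s t : ℝ), |s| ≤ B → |t| ≤ B →
      |bval b * s + bval b' * t| ≤ 2 * (1 + |B|) := fun b b' s t hs ht => by
    refine (abs_add_le _ _).trans ?_
    rw [abs_mul, abs_mul]
    have h1 := mul_le_mul (hb b) (hs.trans hB') (abs_nonneg _) zero_le_one
    have h2 := mul_le_mul (hb b') (ht.trans hB') (abs_nonneg _) zero_le_one
    linarith
  rcases i with i | k | k | k
  · simp only [dyadStat]
    split_ifs
    · rw [abs_mul]
      have := mul_le_mul (hb c.1) (hb c.2) (abs_nonneg _) zero_le_one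
      linarith [abs_nonneg B]
    · have := abs_add_le (bval c.1) (bval c.2)
      linarith [abs_nonneg B, hb c.1, hb c.2]
  · exact key _ _ _ _ (hB _ _ k).1 (hB _ _ k).1
  · exact key _ _ _ _ (hB q.1 q.1 k).2 (hB q.2 q.2 k).2
  · exact key _ _ _ _ (hB q.2 q.2 k).2 (hB q.1 q.1 k).2

variable {n m v w g} in
theorem abs_centredDyad_le {B : ℝ} (hB : ∀ (j1 j2 : Fin n) (k : Fin m),
    |w (v j1 k) (v j2 k)| ≤ B ∧ |g (v j1 k)| ≤ B) (h : Idx m → ℝ) (q : Fin n × Fin n)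
    (c : Bool × Bool) :
    |centredDyad n m v w g θ h q c| ≤ 4 * Fintype.card (Idx m) * (1 + |B|) * ‖h‖ := by
  have hT : ∀ c', |∑ i, h i * dyadStat n m v w g q c' i|
      ≤ Fintype.card (Idx m) * (‖h‖ * (2 * (1 + |B|))) := fun c' =>
    abs_sum_mul_le_card_mul h (abs_dyadStat_le hB q c')
  have hM : |∑ c', dyadProb n m v w g θ q c' * ∑ i, h i * dyadStat n m v w g q c' i|
      ≤ Fintype.card (Idx m) * (‖h‖ * (2 * (1 + |B|))) := by
    calc _ ≤ ∑ c', dyadProb n m v w g θ q c'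
          * (Fintype.card (Idx m) * (‖h‖ * (2 * (1 + |B|)))) := by
          refine (Finset.abs_sum_le_sum_abs _ _).trans (Finset.sum_le_sum fun c' _ => ?_)
          rw [abs_mul, abs_of_nonneg (dyadProb_nonneg n m v w g θ q c')]
          exact mul_le_mul_of_nonneg_left (hT c') (dyadProb_nonneg n m v w g θ q c')
      _ = _ := by rw [← Finset.sum_mul, sum_dyadProb, one_mul]
  have := abs_sub (∑ i, h i * dyadStat n m v w g q c i)
    (∑ c', dyadProb n m v w g θ q c' * ∑ i, h i * dyadStat n m v w g q c' i)
  unfold centredDyad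
  linarith [hT c]

theorem card_pairsLT_le : ((pairsLT n).card : ℝ) ≤ 4 * Ndyads n := by
  have h1 : (pairsLT n).card ≤ n * n := by
    refine (Finset.card_le_univ _).trans ?_
    simp
  have h0 : n ≤ 1 → (pairsLT n).card = 0 := fun hn => by
    rw [Finset.card_eq_zero, pairsLT, Finset.filter_eq_empty_iff]
    rintro ⟨a, b⟩ _
    simp only [Fin.lt_def]
    omega
  have h2 : (pairsLT n).card ≤ 4 * Ndyads n := by
    rcases Nat.lt_or_ge n 2 with hn | hn
    · rw [h0 (by omega)]; exact Nat.zero_le _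
    · unfold Ndyads
      obtain ⟨r, hr⟩ := (Nat.even_mul_pred_self n).two_dvd
      rw [hr, Nat.mul_div_cancel_left _ two_pos]
      obtain ⟨k, rfl⟩ := Nat.exists_eq_add_of_le hn
      have : 2 + k - 1 = k + 1 := by omega
      rw [this] at hr
      nlinarith
  exact_mod_cast h2

variable {n m v w g} in
theorem exists_log_charfun_centredStat {B : ℝ} (hB : ∀ (j1 j2 : Fin n) (k : Fin m),
    |w (v j1 k) (v j2 k)| ≤ B ∧ |g (v j1 k)| ≤ B) (h : Idx m → ℝ)
    (hh : 4 * Fintype.card (Idx m) * (1 + |B|) * ‖h‖ ≤ 1 / 4) {ζ : ℂ} (hζ : ‖ζ‖ ≤ 1) :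
    ∃ c : ℂ, ∑ x ∈ nets n, (Pvec n m v w g θ x : ℂ)
        * Complex.exp (ζ * (centredStat n m v w g θ h x : ℂ)) = Complex.exp c ∧
      ‖c - ζ ^ 2 / 2 * ((∑ k, ∑ l, h k * Ifish n m v w g θ k l * h l : ℝ) : ℂ)‖
        ≤ 16 * Ndyads n * (4 * Fintype.card (Idx m) * (1 + |B|) * ‖h‖) ^ 3 := by
  have hδ0 : 0 ≤ 4 * Fintype.card (Idx m) * (1 + |B|) * ‖h‖ := by positivity
  obtain ⟨c, hc, hcb⟩ := exists_log_charfun_nets_approx (dyadProb_nonneg n m v w g θ)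
    (fun q _ => sum_dyadProb n m v w g θ q)
    (fun q _ => sum_dyadProb_mul_centredDyad n m v w g θ h q) hδ0 hh
    (fun q _ c => abs_centredDyad_le θ hB h q c) hζ
  refine ⟨c, ?_, ?_⟩
  · rw [← hc]
    refine Finset.sum_congr rfl fun x _ => ?_
    rw [Pvec_eq_prod, centredStat_eq_sum]
  · rw [sum_variance_centredDyad] at hcb
    refine hcb.trans ?_
    have := mul_le_mul_of_nonneg_right (card_pairsLT_le n) (pow_nonneg hδ0 3)
    linarith

end Model

section LogPartition

variable {n m : ℕ} {v : Fin n → Fin m → E} {w : E → E → ℝ} {g : E → ℝ}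

theorem convexOn_log_Zvec :
    ConvexOn ℝ Set.univ fun θ : Idx m → ℝ => Real.log (Zvec n m v w g θ) := by
  refine ⟨convex_univ, fun θ _ θ' _ a b ha hb hab => ?_⟩
  have hZ := Zvec_pos n m v w g θ
  have hZ' := Zvec_pos n m v w g θ'
  set l := Real.log (Zvec n m v w g θ) with hl
  set l' := Real.log (Zvec n m v w g θ') with hl'
  have key : Zvec n m v w g (a • θ + b • θ') ≤ Real.exp (a * l + b * l') := by
    have hH : ∀ x, Hvec n m v w g (a • θ + b • θ') x
        = a * Hvec n m v w g θ x + b * Hvec n m v w g θ' x := fun x => by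
      simp only [Hvec, Finset.mul_sum, ← Finset.sum_add_distrib]
      exact Finset.sum_congr rfl fun i _ => by
        simp only [Pi.add_apply, Pi.smul_apply, smul_eq_mul]; ring
    have hx : ∀ x, Real.exp (Hvec n m v w g (a • θ + b • θ') x)
        ≤ Real.exp (a * l + b * l')
          * (a * Pvec n m v w g θ x + b * Pvec n m v w g θ' x) := fun x => by
      have h := convexOn_exp.2 (Set.mem_univ (Hvec n m v w g θ x - l))
        (Set.mem_univ (Hvec n m v w g θ' x - l')) ha hb hab
      simp only [smul_eq_mul, Real.exp_sub, hl, hl', Real.exp_log hZ, Real.exp_log hZ'] at h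
      have e : Hvec n m v w g (a • θ + b • θ') x = (a * l + b * l')
          + (a * (Hvec n m v w g θ x - l) + b * (Hvec n m v w g θ' x - l')) := by
        rw [hH]; ring
      rw [e, Real.exp_add]
      exact mul_le_mul_of_nonneg_left h (Real.exp_pos _).le
    calc Zvec n m v w g (a • θ + b • θ')
        ≤ ∑ x ∈ nets n, Real.exp (a * l + b * l')
          * (a * Pvec n m v w g θ x + b * Pvec n m v w g θ' x) := Finset.sum_le_sum fun x _ => hx x
      _ = Real.exp (a * l + b * l') := by
        rw [← Finset.mul_sum, Finset.sum_add_distrib, ← Finset.mul_sum, ← Finset.mul_sum,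
          sum_Pvec, sum_Pvec, mul_one, mul_one, hab, mul_one]
  simp only [smul_eq_mul]
  rw [Real.log_le_iff_le_exp (Zvec_pos n m v w g _)]
  exact key

theorem sum_Pvec_mul_exp_centredStat (θ h : Idx m → ℝ) :
    ∑ x ∈ nets n, Pvec n m v w g θ x * Real.exp (centredStat n m v w g θ h x)
      = Real.exp (Real.log (Zvec n m v w g (θ + h)) - Real.log (Zvec n m v w g θ)
        - ∑ k, h k * Emean n m v w g θ fun y => svec n m v w g y k) := by
  rw [Real.exp_sub, Real.exp_sub, Real.exp_log (Zvec_pos n m v w g _),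
    Real.exp_log (Zvec_pos n m v w g _), Zvec.eq_def n m v w g (θ + h), Finset.sum_div,
    Finset.sum_div]
  refine Finset.sum_congr rfl fun x _ => ?_
  have e1 : Hvec n m v w g (θ + h) x
      = Hvec n m v w g θ x + ∑ k, h k * svec n m v w g x k := by
    simp only [Hvec, Pi.add_apply, add_mul, Finset.sum_add_distrib]
  have e2 : centredStat n m v w g θ h x = ∑ k, h k * svec n m v w g x k
      - ∑ k, h k * Emean n m v w g θ fun y => svec n m v w g y k := by
    simp only [centredStat, mul_sub, Finset.sum_sub_distrib]
  rw [e1, e2, Real.exp_add, Real.exp_sub, Pvec]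
  ring

theorem abs_log_Zvec_sub_le {B : ℝ} (hB : ∀ (j1 j2 : Fin n) (k : Fin m),
    |w (v j1 k) (v j2 k)| ≤ B ∧ |g (v j1 k)| ≤ B) (θ h : Idx m → ℝ)
    (hh : 4 * Fintype.card (Idx m) * (1 + |B|) * ‖h‖ ≤ 1 / 4) :
    |Real.log (Zvec n m v w g (θ + h)) - Real.log (Zvec n m v w g θ)
        - ∑ k, h k * Emean n m v w g θ (fun y => svec n m v w g y k)
        - (∑ k, ∑ l, h k * Ifish n m v w g θ k l * h l) / 2|
      ≤ 16 * Ndyads n * (4 * Fintype.card (Idx m) * (1 + |B|) * ‖h‖) ^ 3 := by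
  obtain ⟨c, hc, hcb⟩ := exists_log_charfun_centredStat θ hB h hh (ζ := 1) (by simp)
  refine le_trans ?_ hcb
  set L := Real.log (Zvec n m v w g (θ + h)) - Real.log (Zvec n m v w g θ)
    - ∑ k, h k * Emean n m v w g θ fun y => svec n m v w g y k with hL
  have hre : Real.exp L = Real.exp c.re := by
    rw [← Complex.norm_exp, ← hc, hL, ← sum_Pvec_mul_exp_centredStat]
    simp only [one_mul]
    have : ∑ x ∈ nets n, (Pvec n m v w g θ x : ℂ)
        * Complex.exp (centredStat n m v w g θ h x : ℂ)
        = ((∑ x ∈ nets n, Pvec n m v w g θ x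
          * Real.exp (centredStat n m v w g θ h x) : ℝ) : ℂ) := by push_cast; rfl
    rw [this, Complex.norm_real, Real.norm_of_nonneg]
    exact Finset.sum_nonneg fun x _ =>
      mul_nonneg (Pvec_nonneg n m v w g θ x) (Real.exp_pos _).le
  rw [Real.exp_injective hre]
  refine le_trans (le_of_eq ?_) (Complex.abs_re_le_norm _)
  congr 1
  rw [Complex.sub_re, one_pow]
  have : (1 / 2 * ((∑ k, ∑ l, h k * Ifish n m v w g θ k l * h l : ℝ) : ℂ))
    = (((∑ k, ∑ l, h k * Ifish n m v w g θ k l * h l) / 2 : ℝ) : ℂ) := by push_cast; ring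
  rw [this, Complex.ofReal_re]

end LogPartition

open Matrix in
/-- A minimizer of a convex, approximately quadratic function with a weighted absolute value
penalty is close to the minimizer `us` of the quadratic restricted to the coordinates in `A`. -/
theorem norm_sub_le_of_penalized_min {ι : Type*} [Fintype ι] {A : ι → Prop}
    {G : (ι → ℝ) → ℝ} (hG : ConvexOn ℝ Set.univ G) {M : Matrix ι ι ℝ} (hM : M.IsSymm)
    {κ : ℝ} (hκ : ∀ d : ι → ℝ, κ * ‖d‖ ^ 2 ≤ d ⬝ᵥ M *ᵥ d)
    {Δ us uh c b : ι → ℝ} {ε η e : ℝ} (hε : 0 < ε) (hη : 0 ≤ η)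
    (hGe : ∀ u, ‖u‖ ≤ ‖us‖ + ε → |G u - (u ⬝ᵥ M *ᵥ u) / 2| ≤ e)
    (hus : ∀ k, A k → (M *ᵥ us) k = Δ k) (hus0 : ∀ k, ¬ A k → us k = 0)
    (hb : ∀ k, ¬ A k → b k = 0) (hc : ∀ k, 0 ≤ c k) (hcA : ∀ k, A k → c k ≤ η)
    (hcAc : ∀ k, ¬ A k → |(M *ᵥ us) k - Δ k| ≤ c k)
    (hmin : G uh - ∑ k, uh k * Δ k + ∑ k, c k * |b k + uh k|
      ≤ G us - ∑ k, us k * Δ k + ∑ k, c k * |b k + us k|)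
    (hstrict : Fintype.card ι * (η * ε) + 2 * e < κ * ε ^ 2 / 2) :
    ‖uh - us‖ ≤ ε := by
  by_contra! hlt
  have hpos : 0 < ‖uh - us‖ := hε.trans hlt
  set τ := ε / ‖uh - us‖ with hτ
  have hτ0 : 0 ≤ τ := by positivity
  have hτ1 : τ ≤ 1 := (div_le_one hpos).2 hlt.le
  set d : ι → ℝ := τ • (uh - us) with hd
  have hdn : ‖d‖ = ε := by
    rw [hd, norm_smul, Real.norm_of_nonneg hτ0, hτ, div_mul_cancel₀ _ hpos.ne']
  have hcomb : us + d = (1 - τ) • us + τ • uh := by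
    rw [hd]; module
  have hG1 : G (us + d) ≤ (1 - τ) * G us + τ * G uh := by
    rw [hcomb]
    exact hG.2 (Set.mem_univ _) (Set.mem_univ _) (by linarith) hτ0 (by ring)
  have hlin : ∑ k, (us + d) k * Δ k = (1 - τ) * ∑ k, us k * Δ k + τ * ∑ k, uh k * Δ k := by
    rw [hcomb, Finset.mul_sum, Finset.mul_sum, ← Finset.sum_add_distrib]
    exact Finset.sum_congr rfl fun k _ => by
      simp only [Pi.add_apply, Pi.smul_apply, smul_eq_mul]; ring
  have hpen : ∑ k, c k * |b k + (us + d) k|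
      ≤ (1 - τ) * ∑ k, c k * |b k + us k| + τ * ∑ k, c k * |b k + uh k| := by
    rw [hcomb, Finset.mul_sum, Finset.mul_sum, ← Finset.sum_add_distrib]
    refine Finset.sum_le_sum fun k _ => ?_
    have h1 : |b k + ((1 - τ) • us + τ • uh) k|
        ≤ (1 - τ) * |b k + us k| + τ * |b k + uh k| := by
      have e : b k + ((1 - τ) • us + τ • uh) k
          = (1 - τ) * (b k + us k) + τ * (b k + uh k) := by
        simp only [Pi.add_apply, Pi.smul_apply, smul_eq_mul]; ring
      rw [e]
      refine (abs_add_le _ _).trans ?_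
      rw [abs_mul, abs_mul, abs_of_nonneg hτ0, abs_of_nonneg (by linarith : 0 ≤ 1 - τ)]
    nlinarith [hc k]
  have hle : G (us + d) - ∑ k, (us + d) k * Δ k + ∑ k, c k * |b k + (us + d) k|
      ≤ G us - ∑ k, us k * Δ k + ∑ k, c k * |b k + us k| := by
    nlinarith
  have hquad : ((us + d) ⬝ᵥ M *ᵥ (us + d)) / 2 - (us ⬝ᵥ M *ᵥ us) / 2
      = d ⬝ᵥ M *ᵥ us + (d ⬝ᵥ M *ᵥ d) / 2 := by
    have hs : us ⬝ᵥ M *ᵥ d = d ⬝ᵥ M *ᵥ us := by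
      rw [dotProduct_mulVec, ← mulVec_transpose, hM.eq, dotProduct_comm]
    simp only [mulVec_add, dotProduct_add, add_dotProduct, hs]
    ring
  have h1 := (abs_le.1 (hGe (us + d) ((norm_add_le _ _).trans (by rw [hdn])))).1
  have h2 := (abs_le.1 (hGe us (by linarith))).2
  have hterm : ∀ k, -(η * ε) ≤ d k * ((M *ᵥ us) k - Δ k)
      + c k * (|b k + (us + d) k| - |b k + us k|) := fun k => by
    have hdk : |d k| ≤ ε := hdn ▸ norm_le_pi_norm d k
    by_cases hk : A k
    · rw [hus k hk, sub_self, mul_zero, zero_add]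
      have h3 : -|d k| ≤ |b k + (us + d) k| - |b k + us k| := by
        have := abs_sub_abs_le_abs_sub (b k + us k) (b k + (us + d) k)
        have e : b k + us k - (b k + (us + d) k) = -d k := by simp
        rw [e, abs_neg] at this
        linarith
      have h4 : c k * |d k| ≤ η * ε := mul_le_mul (hcA k hk) hdk (abs_nonneg _) hη
      nlinarith [hc k]
    · simp only [Pi.add_apply, hus0 k hk, hb k hk, zero_add, abs_zero, sub_zero]
      have h3 : -(|d k| * |(M *ᵥ us) k - Δ k|) ≤ d k * ((M *ᵥ us) k - Δ k) := by
        rw [← abs_mul]; exact neg_abs_le _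
      have h4 : |d k| * |(M *ᵥ us) k - Δ k| ≤ |d k| * c k :=
        mul_le_mul_of_nonneg_left (hcAc k hk) (abs_nonneg _)
      have h5 : 0 ≤ η * ε := by positivity
      linarith
  have hsum : -(Fintype.card ι * (η * ε)) ≤ ∑ k, (d k * ((M *ᵥ us) k - Δ k)
      + c k * (|b k + (us + d) k| - |b k + us k|)) := by
    have := Finset.card_nsmul_le_sum Finset.univ _ _ fun k _ => hterm k
    rw [nsmul_eq_mul, Finset.card_univ] at this
    linarith
  have hexpand : ∑ k, (d k * ((M *ᵥ us) k - Δ k) + c k * (|b k + (us + d) k| - |b k + us k|))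
      = d ⬝ᵥ M *ᵥ us - (∑ k, (us + d) k * Δ k - ∑ k, us k * Δ k)
        + (∑ k, c k * |b k + (us + d) k| - ∑ k, c k * |b k + us k|) := by
    simp only [dotProduct, ← Finset.sum_sub_distrib, ← Finset.sum_add_distrib]
    exact Finset.sum_congr rfl fun k _ => by rw [Pi.add_apply]; ring
  have h6 := hκ d
  rw [hdn] at h6
  linarith

section Gaussian

open MeasureTheory Matrix

theorem exists_sqrt_factor {A : Type*} [Fintype A] {S : Matrix A A ℝ} (hS : S.PosDef) :
    ∃ B : Matrix A A ℝ, S = Bᵀ * B := by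
  open scoped MatrixOrder Matrix.Norms.L2Operator in
  obtain ⟨B, hB⟩ := CStarAlgebra.nonneg_iff_eq_star_mul_self.mp hS.posSemidef.nonneg
  exact ⟨B, by rw [hB, star_eq_conjTranspose, conjTranspose_eq_transpose_of_trivial]⟩

theorem integral_comp_mulVec {A : Type*} [Fintype A] {B : Matrix A A ℝ} (hB : B.det ≠ 0)
    {f : (A → ℝ) → ℂ} (hf : Continuous f) :
    ∫ u, f (B *ᵥ u) = ((|B.det|⁻¹ : ℝ) : ℂ) * ∫ z, f z := by
  have h := Real.map_matrix_volume_pi_eq_smul_volume_pi hB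
  have hmeas : Measurable (toLin' B) :=
    (LinearMap.continuous_of_finiteDimensional _).measurable
  have h2 := integral_map (μ := volume) hmeas.aemeasurable (f := f)
    hf.measurable.aestronglyMeasurable
  rw [h, integral_smul_measure, ENNReal.toReal_ofReal (abs_nonneg _), abs_inv,
    Complex.real_smul] at h2
  rw [h2]
  rfl

theorem integral_gaussPrec_cexp {A : Type*} [Fintype A] {S : Matrix A A ℝ} (hS : S.PosDef)
    (t : A → ℝ) :
    ∫ u, Complex.exp (((∑ k, u k * t k : ℝ) : ℂ) * Complex.I) ∂(gaussPrec S)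
      = Complex.exp (-((t ⬝ᵥ S⁻¹ *ᵥ t / 2 : ℝ) : ℂ)) := by
  obtain ⟨B, hB⟩ := exists_sqrt_factor hS
  have hdet : S.det = B.det ^ 2 := by rw [hB, det_mul, det_transpose, sq]
  have hB0 : B.det ≠ 0 := fun h => hS.det_pos.ne' (by rw [hdet, h]; ring)
  have hBu : IsUnit B.det := isUnit_iff_ne_zero.2 hB0
  set s : A → ℝ := (B⁻¹)ᵀ *ᵥ t with hs
  have hss : ∑ k, s k ^ 2 = t ⬝ᵥ S⁻¹ *ᵥ t := by
    have e : ∑ k, s k ^ 2 = s ⬝ᵥ s := by simp only [dotProduct, sq]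
    have e2 : S⁻¹ = B⁻¹ * (B⁻¹)ᵀ := by
      rw [hB, Matrix.mul_inv_rev, transpose_nonsing_inv]
    rw [e, e2, ← mulVec_mulVec, dotProduct_mulVec t B⁻¹, ← mulVec_transpose]
  have hst : ∀ u : A → ℝ, ∑ k, s k * (B *ᵥ u) k = ∑ k, u k * t k := fun u => by
    change s ⬝ᵥ B *ᵥ u = u ⬝ᵥ t
    rw [hs, dotProduct_comm, dotProduct_mulVec, vecMul_transpose, mulVec_mulVec,
      nonsing_inv_mul _ hBu, one_mulVec]
  have hquad : ∀ u : A → ℝ, ∑ k, (B *ᵥ u) k ^ 2 = ∑ k, ∑ l, u k * S k l * u l := fun u => by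
    have e : ∑ k, (B *ᵥ u) k ^ 2 = (B *ᵥ u) ⬝ᵥ (B *ᵥ u) := by simp only [dotProduct, sq]
    rw [e, dotProduct_mulVec, ← mulVec_transpose, mulVec_mulVec, ← hB, dotProduct_comm]
    simp only [dotProduct, mulVec, Finset.mul_sum, mul_assoc]
  set C : ℝ := (2 * Real.pi) ^ (-(Fintype.card A : ℝ) / 2) * Real.sqrt S.det with hC
  have hC0 : 0 ≤ C := by positivity
  have hdens : Measurable fun u : A → ℝ => ENNReal.ofReal
      (C * Real.exp (-(∑ k, ∑ l, u k * S k l * u l) / 2)) := by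
    apply ENNReal.measurable_ofReal.comp
    apply Continuous.measurable
    fun_prop
  set f : (A → ℝ) → ℂ := fun z =>
    Complex.exp (-(1 / 2 : ℂ) * ∑ i, (z i : ℂ) ^ 2 + ∑ i, (s i * Complex.I) * z i) with hf
  have hfc : Continuous f := by
    rw [hf]; fun_prop
  have hint : ∀ u : A → ℝ,
      (ENNReal.ofReal (C * Real.exp (-(∑ k, ∑ l, u k * S k l * u l) / 2))).toReal
        • Complex.exp (((∑ k, u k * t k : ℝ) : ℂ) * Complex.I) = (C : ℂ) * f (B *ᵥ u) := fun u => by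
    rw [ENNReal.toReal_ofReal (by positivity), Complex.real_smul, Complex.ofReal_mul, mul_assoc,
      Complex.ofReal_exp, ← Complex.exp_add, ← hquad, ← hst, hf]
    congr 2
    push_cast
    rw [Finset.sum_mul]
    congr 1
    · ring
    · exact Finset.sum_congr rfl fun k _ => by ring
  have hgauss : gaussPrec S = volume.withDensity fun u : A → ℝ => ENNReal.ofReal
      (C * Real.exp (-(∑ k, ∑ l, u k * S k l * u l) / 2)) := rfl
  rw [hgauss, integral_withDensity_eq_integral_toReal_smul hdens
    (Filter.Eventually.of_forall fun _ => ENNReal.ofReal_lt_top)]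
  simp only [hint]
  rw [integral_const_mul, integral_comp_mulVec hB0 hfc, hf,
    GaussianFourier.integral_cexp_neg_mul_sum_add (by norm_num)]
  have hsum : (∑ i, ((s i : ℂ) * Complex.I) ^ 2) / (4 * (1 / 2))
      = -((t ⬝ᵥ S⁻¹ *ᵥ t / 2 : ℝ) : ℂ) := by
    rw [← hss]
    push_cast
    simp only [mul_pow, Complex.I_sq, mul_neg, mul_one, Finset.sum_neg_distrib]
    ring
  rw [hsum]
  have hpow : ((Real.pi : ℂ) / (1 / 2)) ^ ((Fintype.card A : ℂ) / 2)
      = (((2 * Real.pi) ^ ((Fintype.card A : ℝ) / 2) : ℝ) : ℂ) := by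
    rw [Complex.ofReal_cpow (by positivity)]
    push_cast
    congr 1
    ring
  have hconst : C * (|B.det|⁻¹ * (2 * Real.pi) ^ ((Fintype.card A : ℝ) / 2)) = 1 := by
    rw [hC, hdet, Real.sqrt_sq_eq_abs]
    have h1 : |B.det| * |B.det|⁻¹ = 1 := mul_inv_cancel₀ (abs_ne_zero.2 hB0)
    have h2 : (2 * Real.pi) ^ (-(Fintype.card A : ℝ) / 2)
        * (2 * Real.pi) ^ ((Fintype.card A : ℝ) / 2) = 1 := by
      rw [← Real.rpow_add (by positivity)]
      rw [neg_div, neg_add_cancel, Real.rpow_zero]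
    rw [mul_assoc, ← mul_assoc |B.det|, h1, one_mul, h2]
  rw [hpow]
  have := congrArg (fun r : ℝ => (r : ℂ)) hconst
  push_cast at this ⊢
  linear_combination Complex.exp (-((t ⬝ᵥ S⁻¹ *ᵥ t : ℝ) / 2 : ℂ)) * this

theorem isProbabilityMeasure_gaussPrec {A : Type*} [Fintype A] {S : Matrix A A ℝ}
    (hS : S.PosDef) : IsProbabilityMeasure (gaussPrec S) := by
  have h := integral_gaussPrec_cexp hS 0
  simp only [Pi.zero_apply, mul_zero, Finset.sum_const_zero, Complex.ofReal_zero, zero_mul,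
    Complex.exp_zero, integral_const, zero_dotProduct, zero_div, neg_zero,
    Complex.real_smul, mul_one] at h
  have h1 : (gaussPrec S).real Set.univ = 1 := by exact_mod_cast h
  refine ⟨?_⟩
  rwa [Measure.real, ENNReal.toReal_eq_one_iff] at h1

/-- Weak convergence of weighted point masses to a Gaussian law follows from the convergence of
the characteristic functions. -/
theorem tendsto_gaussPrec_of_charFun {A : Type*} [Fintype A] [DecidableEq A] {S : Matrix A A ℝ}
    (hS : S.PosDef)
    {X : ℕ → Type*} (s : (n : ℕ) → Finset (X n)) (P : (n : ℕ) → X n → ℝ)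
    (hP0 : ∀ n x, 0 ≤ P n x) (hP1 : ∀ n, ∑ x ∈ s n, P n x = 1) (U : (n : ℕ) → X n → A → ℝ)
    (h : ∀ t : A → ℝ, Filter.Tendsto
      (fun n => ∑ x ∈ s n, (P n x : ℂ)
        * Complex.exp (((∑ k, U n x k * t k : ℝ) : ℂ) * Complex.I))
      Filter.atTop (nhds (Complex.exp (-((t ⬝ᵥ S⁻¹ *ᵥ t / 2 : ℝ) : ℂ)))))
    (f : BoundedContinuousFunction (A → ℝ) ℝ) :
    Filter.Tendsto (fun n => ∑ x ∈ s n, f (U n x) * P n x) Filter.atTop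
      (nhds (∫ u, f u ∂(gaussPrec S))) := by
  have hprob := isProbabilityMeasure_gaussPrec hS
  set L : (A → ℝ) → EuclideanSpace ℝ A := WithLp.toLp 2 with hL
  have hLm : Measurable L := (PiLp.continuous_toLp 2 _).measurable
  set ν : ℕ → Measure (EuclideanSpace ℝ A) := fun n =>
    ∑ x ∈ s n, ENNReal.ofReal (P n x) • Measure.dirac (L (U n x)) with hν
  have hνint : ∀ {F : Type} [NormedAddCommGroup F] [NormedSpace ℝ F] [CompleteSpace F] (n : ℕ)
      (φ : EuclideanSpace ℝ A → F), ∫ y, φ y ∂(ν n) = ∑ x ∈ s n, P n x • φ (L (U n x)) := by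
    intro F _ _ _ n φ
    rw [hν, integral_finsetSum_measure]
    · refine Finset.sum_congr rfl fun x _ => ?_
      rw [integral_smul_measure, integral_dirac, ENNReal.toReal_ofReal (hP0 n x)]
    · intro x _
      exact (integrable_dirac (by simp)).smul_measure ENNReal.ofReal_ne_top
  have hνp : ∀ n, IsProbabilityMeasure (ν n) := fun n => ⟨by
    simp only [hν, Measure.coe_finsetSum, Finset.sum_apply, Measure.smul_apply,
      measure_univ, smul_eq_mul, mul_one]
    rw [← ENNReal.ofReal_sum_of_nonneg fun x _ => hP0 n x, hP1, ENNReal.ofReal_one]⟩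
  have hmap : IsProbabilityMeasure ((gaussPrec S).map L) :=
    Measure.isProbabilityMeasure_map hLm.aemeasurable
  have hconv : Filter.Tendsto (β := ProbabilityMeasure (EuclideanSpace ℝ A))
      (fun n => ⟨ν n, hνp n⟩) Filter.atTop (nhds ⟨(gaussPrec S).map L, hmap⟩) := by
    refine ProbabilityMeasure.tendsto_of_tendsto_charFun fun t => ?_
    have hin : ∀ u : A → ℝ, inner ℝ (L u) t = ∑ k, u k * t k := fun u => by
      simp [hL, PiLp.inner_apply, mul_comm]
    simp only [ProbabilityMeasure.coe_mk, charFun_apply, hνint]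
    rw [integral_map hLm.aemeasurable (by
      apply Continuous.aestronglyMeasurable
      fun_prop)]
    simp only [hin, Complex.real_smul]
    rw [integral_gaussPrec_cexp hS]
    convert h t
  have := ProbabilityMeasure.tendsto_iff_forall_integral_tendsto.mp hconv
    (f.compContinuous ⟨WithLp.ofLp, PiLp.continuous_ofLp 2 _⟩)
  simp only [ProbabilityMeasure.coe_mk, hνint] at this
  rw [integral_map hLm.aemeasurable (by
    exact (BoundedContinuousFunction.continuous _).aestronglyMeasurable)] at this
  simpa [hL, mul_comm] using this

end Gaussian

section ActiveBlock

open Matrix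

theorem exists_pos_mul_norm_sq_le {ι : Type*} [Fintype ι] {M : Matrix ι ι ℝ} (hM : M.PosDef) :
    ∃ κ > 0, ∀ d : ι → ℝ, κ * ‖d‖ ^ 2 ≤ d ⬝ᵥ M *ᵥ d := by
  have hpos : ∀ d : ι → ℝ, d ≠ 0 → 0 < d ⬝ᵥ M *ᵥ d := fun d hd => by
    simpa using hM.dotProduct_mulVec_pos hd
  have hcont : Continuous fun d : ι → ℝ => d ⬝ᵥ M *ᵥ d := by fun_prop
  have hscale : ∀ d : ι → ℝ, d ≠ 0 → ‖d‖⁻¹ • d ∈ Metric.sphere (0 : ι → ℝ) 1 := fun d hd => by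
    rw [mem_sphere_zero_iff_norm, norm_smul, norm_inv, norm_norm,
      inv_mul_cancel₀ (norm_ne_zero_iff.2 hd)]
  have hmin : ∃ κ > 0, ∀ d ∈ Metric.sphere (0 : ι → ℝ) 1, κ ≤ d ⬝ᵥ M *ᵥ d := by
    rcases (Metric.sphere (0 : ι → ℝ) 1).eq_empty_or_nonempty with h | h
    · exact ⟨1, one_pos, by simp [h]⟩
    · obtain ⟨d, hd, hdmin⟩ := (isCompact_sphere (0 : ι → ℝ) 1).exists_isMinOn h hcont.continuousOn
      refine ⟨_, hpos d ?_, fun d' hd' => hdmin hd'⟩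
      rintro rfl
      simp at hd
  obtain ⟨κ, hκ, hle⟩ := hmin
  refine ⟨κ, hκ, fun d => ?_⟩
  rcases eq_or_ne d 0 with rfl | hd
  · simp
  · have h := hle _ (hscale d hd)
    have hn : 0 < ‖d‖ := norm_pos_iff.2 hd
    rw [mulVec_smul, smul_dotProduct, dotProduct_smul, smul_eq_mul, smul_eq_mul, ← mul_assoc,
      ← mul_inv, ← div_eq_inv_mul, le_div_iff₀ (by positivity)] at h
    rwa [sq]

theorem sum_eq_sum_subtype_of_forall_not {ι : Type*} [Fintype ι] {A : ι → Prop}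
    [Fintype {k // A k}] {f : ι → ℝ} (hf : ∀ k, ¬ A k → f k = 0) :
    ∑ k, f k = ∑ k : {k // A k}, f k := by
  rw [← Fintype.sum_subtype_add_sum_subtype A,
    Finset.sum_eq_zero fun (k : {k // ¬ A k}) _ => hf k k.2, add_zero]
  congr!

/-- A vector supported on `A` solves the equations of a positive definite system indexed by `A`;
the solution depends linearly on the right-hand side. -/
theorem exists_activeSolve {ι : Type*} [Fintype ι] {M : Matrix ι ι ℝ} (hM : M.PosDef)
    (A : ι → Prop) [Fintype {k // A k}] [DecidableEq {k // A k}] :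
    ∃ T : (ι → ℝ) →ₗ[ℝ] (ι → ℝ), (∀ y k, A k → (M *ᵥ T y) k = y k) ∧ (∀ y k, ¬ A k → T y k = 0)
      ∧ ∀ y (k : {k // A k}), T y k
        = ((Matrix.of fun k l : {k // A k} => M k.1 l.1)⁻¹ *ᵥ fun l => y l.1) k := by
  set S : Matrix {k // A k} {k // A k} ℝ := Matrix.of fun k l => M k.1 l.1 with hS
  have hSpd : S.PosDef := hM.submatrix Subtype.val_injective
  have hSu : IsUnit S.det := isUnit_iff_ne_zero.2 hSpd.det_pos.ne'
  let T : (ι → ℝ) →ₗ[ℝ] (ι → ℝ) :=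
    { toFun := fun y k => if h : A k then (S⁻¹ *ᵥ fun l => y l.1) ⟨k, h⟩ else 0
      map_add' := fun y z => by
        ext k
        by_cases h : A k
        · simp [h, mulVec, dotProduct, mul_add, Finset.sum_add_distrib]
        · simp [h]
      map_smul' := fun c y => by
        ext k
        by_cases h : A k
        · simp [h, mulVec, dotProduct, Finset.mul_sum, mul_left_comm]
        · simp [h] }
  have hT0 : ∀ y k, ¬ A k → T y k = 0 := fun y k hk => dif_neg hk
  have hT1 : ∀ y (k : {k // A k}), T y k = (S⁻¹ *ᵥ fun l => y l.1) k := fun y k => dif_pos k.2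
  refine ⟨T, fun y k hk => ?_, hT0, hT1⟩
  have h1 : (M *ᵥ T y) k = (S *ᵥ (S⁻¹ *ᵥ fun l => y l.1)) ⟨k, hk⟩ := by
    simp only [mulVec, dotProduct, hS, Matrix.of_apply]
    rw [sum_eq_sum_subtype_of_forall_not fun l hl => by rw [hT0 _ _ hl, mul_zero]]
    exact Finset.sum_congr rfl fun l _ => by rw [hT1]; rfl
  rw [h1, mulVec_mulVec, mul_nonsing_inv _ hSu, one_mulVec]

end ActiveBlock

theorem tendsto_Ndyads : Filter.Tendsto (fun n => (Ndyads n : ℝ)) Filter.atTop Filter.atTop := by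
  refine tendsto_natCast_atTop_atTop.comp
    (Filter.tendsto_atTop_mono (fun n => ?_) (Filter.tendsto_sub_atTop_nat 1))
  rw [Ndyads, Nat.le_div_iff_mul_le two_pos]
  rcases n with _ | _ | n
  · simp
  · simp
  · rw [mul_comm]
    exact Nat.mul_le_mul_right _ (by lia)

theorem tendsto_inv_sqrt_Ndyads :
    Filter.Tendsto (fun n => (√(Ndyads n : ℝ))⁻¹) Filter.atTop (nhds 0) :=
  (Real.tendsto_sqrt_atTop.comp tendsto_Ndyads).inv_tendsto_atTop

theorem eventually_sqrt_Ndyads_pos : ∀ᶠ n in Filter.atTop, 0 < √(Ndyads n : ℝ) :=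
  (Real.tendsto_sqrt_atTop.comp tendsto_Ndyads).eventually_gt_atTop 0

section Local

variable (n m : ℕ) (v : Fin n → Fin m → E) (w : E → E → ℝ) (g : E → ℝ) (θ : Idx m → ℝ) (r : ℝ)

/-- The score at `θ` divided by `r`. -/
def scaledScore (x : Fin n → Fin n → Bool) : Idx m → ℝ := fun k =>
  r⁻¹ * (svec n m v w g x k - Emean n m v w g θ fun y => svec n m v w g y k)

/-- The log-partition function in the local parameter `u`, centred to second order at `θ`. -/
def localLogZ (u : Idx m → ℝ) : ℝ :=
  Real.log (Zvec n m v w g (θ + r⁻¹ • u)) - Real.log (Zvec n m v w g θ)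
    - ∑ k, (r⁻¹ • u) k * Emean n m v w g θ fun y => svec n m v w g y k

theorem convexOn_localLogZ : ConvexOn ℝ Set.univ (localLogZ n m v w g θ r) := by
  refine ⟨convex_univ, fun u _ u' _ a b ha hb hab => ?_⟩
  have h := (convexOn_log_Zvec (v := v) (w := w) (g := g)).2 (Set.mem_univ (θ + r⁻¹ • u))
    (Set.mem_univ (θ + r⁻¹ • u')) ha hb hab
  obtain rfl : b = 1 - a := by linarith
  have e : a • (θ + r⁻¹ • u) + (1 - a) • (θ + r⁻¹ • u')
    = θ + r⁻¹ • (a • u + (1 - a) • u') := by module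
  have hlin : ∑ k, (r⁻¹ • (a • u + (1 - a) • u')) k
        * (Emean n m v w g θ fun y => svec n m v w g y k)
      = a * ∑ k, (r⁻¹ • u) k * (Emean n m v w g θ fun y => svec n m v w g y k)
        + (1 - a) * ∑ k, (r⁻¹ • u') k * (Emean n m v w g θ fun y => svec n m v w g y k) := by
    rw [Finset.mul_sum, Finset.mul_sum, ← Finset.sum_add_distrib]
    exact Finset.sum_congr rfl fun k _ => by
      simp only [Pi.add_apply, Pi.smul_apply, smul_eq_mul]; ring
  simp only [localLogZ, hlin, smul_eq_mul]
  simp only [e, smul_eq_mul] at h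
  linarith

theorem neg_Llik_add_penalty_eq {r : ℝ} (hr : 0 < r) (l : ℝ) (W u : Idx m → ℝ)
    (x : Fin n → Fin n → Bool) :
    -Llik n m v w g (θ + r⁻¹ • u) x + l * ∑ k, W k * |(θ + r⁻¹ • u) k|
      = localLogZ n m v w g θ r u - ∑ k, u k * scaledScore n m v w g θ r x k
        + ∑ k, l * W k / r * |r * θ k + u k| + (Real.log (Zvec n m v w g θ) - Hvec n m v w g θ x) := by
  have h1 : Hvec n m v w g (θ + r⁻¹ • u) x
      = Hvec n m v w g θ x + ∑ k, (r⁻¹ • u) k * svec n m v w g x k := by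
    simp only [Hvec, Pi.add_apply, add_mul, Finset.sum_add_distrib]
  have h2 : ∑ k, u k * scaledScore n m v w g θ r x k
      = ∑ k, (r⁻¹ • u) k * svec n m v w g x k
        - ∑ k, (r⁻¹ • u) k * Emean n m v w g θ fun y => svec n m v w g y k := by
    rw [← Finset.sum_sub_distrib]
    exact Finset.sum_congr rfl fun k _ => by
      simp only [scaledScore, Pi.smul_apply, smul_eq_mul]; ring
  have h3 : l * ∑ k, W k * |(θ + r⁻¹ • u) k| = ∑ k, l * W k / r * |r * θ k + u k| := by
    rw [Finset.mul_sum]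
    refine Finset.sum_congr rfl fun k _ => ?_
    have : r * θ k + u k = r * (θ + r⁻¹ • u) k := by
      simp only [Pi.add_apply, Pi.smul_apply, smul_eq_mul]; field_simp
    rw [this, abs_mul, abs_of_pos hr]
    field_simp
  rw [Llik, localLogZ, h1, h2, h3]
  ring

theorem Pr_le_add_three {φ a b c : (Fin n → Fin n → Bool) → Prop}
    (h : ∀ x ∈ nets n, φ x → a x ∨ b x ∨ c x) :
    Pr n m v w g θ φ ≤ Pr n m v w g θ a + Pr n m v w g θ b + Pr n m v w g θ c := by
  simp only [Pr, Finset.sum_filter, ← Finset.sum_add_distrib]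
  refine Finset.sum_le_sum fun x hx => ?_
  have hP := Pvec_nonneg n m v w g θ x
  have := h x hx
  split_ifs <;> first | linarith | tauto

theorem Pr_lt_norm_scaledScore_mul_sq_le {R : ℝ} (hR : 0 ≤ R) :
    Pr n m v w g θ (fun x => R < ‖scaledScore n m v w g θ r x‖) * R ^ 2
      ≤ ∑ k, r⁻¹ ^ 2 * Ifish n m v w g θ k k := by
  have h1 : ∑ k, r⁻¹ ^ 2 * Ifish n m v w g θ k k
      = ∑ x ∈ nets n, (∑ k, scaledScore n m v w g θ r x k ^ 2) * Pvec n m v w g θ x := by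
    simp only [← Emean_centred_mul, Emean, Finset.sum_mul, Finset.mul_sum]
    rw [Finset.sum_comm]
    refine Finset.sum_congr rfl fun x _ => Finset.sum_congr rfl fun k _ => ?_
    simp only [scaledScore, Emean]
    ring
  rw [h1, Pr, Finset.sum_filter, Finset.sum_mul]
  refine Finset.sum_le_sum fun x _ => ?_
  have hP := Pvec_nonneg n m v w g θ x
  split_ifs with hx
  · rw [mul_comm]
    refine mul_le_mul_of_nonneg_right ?_ hP
    obtain ⟨k, hk⟩ : ∃ k, R < ‖scaledScore n m v w g θ r x k‖ := by
      by_contra! hall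
      exact hx.not_ge ((pi_norm_le_iff_of_nonneg hR).2 hall)
    calc R ^ 2 ≤ ‖scaledScore n m v w g θ r x k‖ ^ 2 := by gcongr
      _ = scaledScore n m v w g θ r x k ^ 2 := by rw [Real.norm_eq_abs, sq_abs]
      _ ≤ _ := Finset.single_le_sum (f := fun k => scaledScore n m v w g θ r x k ^ 2)
        (fun i _ => sq_nonneg _) (Finset.mem_univ k)
  · rw [zero_mul]
    exact mul_nonneg (Finset.sum_nonneg fun i _ => sq_nonneg _) hP

theorem norm_sum_Pvec_mul_cexp_sub_le {α β : (Fin n → Fin n → Bool) → ℝ}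
    {φ : (Fin n → Fin n → Bool) → Prop} {δ : ℝ} (hδ : 0 ≤ δ)
    (h : ∀ x ∈ nets n, ¬ φ x → |α x - β x| ≤ δ) :
    ‖∑ x ∈ nets n, (Pvec n m v w g θ x : ℂ) * Complex.exp ((α x : ℂ) * Complex.I)
        - ∑ x ∈ nets n, (Pvec n m v w g θ x : ℂ) * Complex.exp ((β x : ℂ) * Complex.I)‖
      ≤ δ + 2 * Pr n m v w g θ φ := by
  rw [← Finset.sum_sub_distrib]
  have hb : δ + 2 * Pr n m v w g θ φ
      = ∑ x ∈ nets n, Pvec n m v w g θ x * (δ + if φ x then 2 else 0) := by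
    simp only [mul_add, Finset.sum_add_distrib, ← Finset.sum_mul, sum_Pvec, one_mul, Pr,
      Finset.sum_filter, Finset.mul_sum]
    congr 1
    exact Finset.sum_congr rfl fun x _ => by split_ifs <;> ring
  rw [hb]
  refine norm_sum_le_of_le _ fun x hx => ?_
  have hP := Pvec_nonneg n m v w g θ x
  rw [← mul_sub, norm_mul, Complex.norm_real, Real.norm_of_nonneg hP]
  refine mul_le_mul_of_nonneg_left ?_ hP
  split_ifs with hφ
  · refine (norm_sub_le _ _).trans ?_
    rw [Complex.norm_exp_ofReal_mul_I, Complex.norm_exp_ofReal_mul_I]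
    linarith
  · have e : Complex.exp ((α x : ℂ) * Complex.I) - Complex.exp ((β x : ℂ) * Complex.I)
        = Complex.exp ((β x : ℂ) * Complex.I)
          * (Complex.exp (Complex.I * ((α x - β x : ℝ) : ℂ)) - 1) := by
      rw [mul_sub, ← Complex.exp_add, mul_one]
      congr 2
      push_cast
      ring
    rw [e, norm_mul, Complex.norm_exp_ofReal_mul_I, one_mul, add_zero]
    exact (Real.norm_exp_I_mul_ofReal_sub_one_le).trans (h x hx hφ)

end Local

section Limits

open Matrix

variable {m : ℕ} {v : (n : ℕ) → Fin n → Fin m → E} {w : E → E → ℝ} {g : E → ℝ}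
  {θ0 : Idx m → ℝ} {M : Matrix (Idx m) (Idx m) ℝ}

theorem eventually_abs_quad_sub_le
    (hI : Filter.Tendsto (fun n : ℕ => ((Ndyads n : ℝ))⁻¹ • Ifish n m (v n) w g θ0)
      Filter.atTop (nhds M)) (R : ℝ) {e : ℝ} (he : 0 < e) :
    ∀ᶠ n : ℕ in Filter.atTop, ∀ u : Idx m → ℝ, ‖u‖ ≤ R →
      |∑ k, ∑ l, ((√(Ndyads n : ℝ))⁻¹ • u) k * Ifish n m (v n) w g θ0 k l
          * ((√(Ndyads n : ℝ))⁻¹ • u) l - u ⬝ᵥ M *ᵥ u| ≤ e := by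
  have hlim : Filter.Tendsto (fun n : ℕ => ∑ k, ∑ l,
      R * |(((Ndyads n : ℝ))⁻¹ • Ifish n m (v n) w g θ0) k l - M k l| * R)
      Filter.atTop (nhds (∑ k : Idx m, ∑ l : Idx m, R * |M k l - M k l| * R)) := by
    refine tendsto_finsetSum _ fun k _ => tendsto_finsetSum _ fun l _ => ?_
    have hkl := tendsto_pi_nhds.1 (tendsto_pi_nhds.1 hI k) l
    exact (((hkl.sub_const _).abs).const_mul R).mul_const R
  simp only [sub_self, abs_zero, mul_zero, zero_mul, Finset.sum_const_zero] at hlim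
  filter_upwards [hlim.eventually_le_const he] with n hn u hu
  refine le_trans ?_ hn
  have hR : 0 ≤ R := (norm_nonneg u).trans hu
  have hsq : (√(Ndyads n : ℝ))⁻¹ * (√(Ndyads n : ℝ))⁻¹ = (Ndyads n : ℝ)⁻¹ := by
    rw [← mul_inv, Real.mul_self_sqrt (Nat.cast_nonneg _)]
  have hdiff : ∑ k, ∑ l, ((√(Ndyads n : ℝ))⁻¹ • u) k * Ifish n m (v n) w g θ0 k l
        * ((√(Ndyads n : ℝ))⁻¹ • u) l - u ⬝ᵥ M *ᵥ u
      = ∑ k, ∑ l, u k * ((((Ndyads n : ℝ))⁻¹ • Ifish n m (v n) w g θ0) k l - M k l) * u l := by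
    simp only [dotProduct, mulVec, Finset.mul_sum, ← Finset.sum_sub_distrib]
    refine Finset.sum_congr rfl fun k _ => Finset.sum_congr rfl fun l _ => ?_
    rw [Matrix.smul_apply, ← hsq]
    simp only [Pi.smul_apply, smul_eq_mul]
    ring
  rw [hdiff]
  refine (Finset.abs_sum_le_sum_abs _ _).trans (Finset.sum_le_sum fun k _ =>
    (Finset.abs_sum_le_sum_abs _ _).trans (Finset.sum_le_sum fun l _ => ?_))
  rw [abs_mul, abs_mul]
  have hk : |u k| ≤ R := (norm_le_pi_norm u k).trans hu
  have hl : |u l| ≤ R := (norm_le_pi_norm u l).trans hu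
  gcongr

theorem eventually_cubic_error_le (C R : ℝ) {e : ℝ} (he : 0 < e) (hC : 0 ≤ C) :
    ∀ᶠ n : ℕ in Filter.atTop, ∀ u : Idx m → ℝ, ‖u‖ ≤ R →
      C * ‖(√(Ndyads n : ℝ))⁻¹ • u‖ ≤ 1 / 4 ∧
        16 * Ndyads n * (C * ‖(√(Ndyads n : ℝ))⁻¹ • u‖) ^ 3 ≤ e := by
  have h1 : Filter.Tendsto (fun n => C * ((√(Ndyads n : ℝ))⁻¹ * R)) Filter.atTop (nhds 0) := by
    simpa using (tendsto_inv_sqrt_Ndyads.mul_const R).const_mul C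
  have h2 : Filter.Tendsto (fun n => 16 * (C * R) ^ 3 * (√(Ndyads n : ℝ))⁻¹)
      Filter.atTop (nhds 0) := by
    simpa using tendsto_inv_sqrt_Ndyads.const_mul (16 * (C * R) ^ 3)
  filter_upwards [h1.eventually_le_const (show (0 : ℝ) < 1 / 4 by norm_num),
    h2.eventually_le_const he, eventually_sqrt_Ndyads_pos] with n hn1 hn2 hpos u hu
  have hle : C * ‖(√(Ndyads n : ℝ))⁻¹ • u‖ ≤ C * ((√(Ndyads n : ℝ))⁻¹ * R) := by
    rw [norm_smul, Real.norm_of_nonneg (by positivity)]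
    gcongr
  refine ⟨hle.trans hn1, le_trans ?_ hn2⟩
  have hN : (Ndyads n : ℝ) = √(Ndyads n : ℝ) ^ 2 := (Real.sq_sqrt (Nat.cast_nonneg _)).symm
  calc 16 * Ndyads n * (C * ‖(√(Ndyads n : ℝ))⁻¹ • u‖) ^ 3
      ≤ 16 * Ndyads n * (C * ((√(Ndyads n : ℝ))⁻¹ * R)) ^ 3 := by gcongr
    _ = 16 * (√(Ndyads n : ℝ)) ^ 2 * (C * ((√(Ndyads n : ℝ))⁻¹ * R)) ^ 3 := by rw [← hN]
    _ = 16 * (C * R) ^ 3 * (√(Ndyads n : ℝ))⁻¹ := by field_simp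

theorem eventually_abs_localLogZ_sub_le
    {B : ℝ} (hB : ∀ (n : ℕ) (j1 j2 : Fin n) (k : Fin m),
      |w (v n j1 k) (v n j2 k)| ≤ B ∧ |g (v n j1 k)| ≤ B)
    (hI : Filter.Tendsto (fun n : ℕ => ((Ndyads n : ℝ))⁻¹ • Ifish n m (v n) w g θ0)
      Filter.atTop (nhds M)) (R : ℝ) {e : ℝ} (he : 0 < e) :
    ∀ᶠ n : ℕ in Filter.atTop, ∀ u : Idx m → ℝ, ‖u‖ ≤ R →
      |localLogZ n m (v n) w g θ0 √(Ndyads n : ℝ) u - (u ⬝ᵥ M *ᵥ u) / 2| ≤ e := by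
  filter_upwards [eventually_abs_quad_sub_le hI R he,
    eventually_cubic_error_le (m := m) (4 * Fintype.card (Idx m) * (1 + |B|)) R (half_pos he)
      (by positivity)] with n hq hc u hu
  have h1 := hq u hu
  obtain ⟨h2, h3⟩ := hc u hu
  have h4 := (abs_log_Zvec_sub_le (hB n) θ0 _ h2).trans h3
  rw [← localLogZ] at h4
  rw [abs_le] at h1 h4 ⊢
  constructor <;> linarith [h1.1, h1.2, h4.1, h4.2]

theorem tendsto_charFun_centredStat
    {B : ℝ} (hB : ∀ (n : ℕ) (j1 j2 : Fin n) (k : Fin m),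
      |w (v n j1 k) (v n j2 k)| ≤ B ∧ |g (v n j1 k)| ≤ B)
    (hI : Filter.Tendsto (fun n : ℕ => ((Ndyads n : ℝ))⁻¹ • Ifish n m (v n) w g θ0)
      Filter.atTop (nhds M)) (q : Idx m → ℝ) :
    Filter.Tendsto (fun n : ℕ => ∑ x ∈ nets n, (Pvec n m (v n) w g θ0 x : ℂ)
      * Complex.exp ((centredStat n m (v n) w g θ0 ((√(Ndyads n : ℝ))⁻¹ • q) x : ℂ) * Complex.I))
      Filter.atTop (nhds (Complex.exp (-((q ⬝ᵥ M *ᵥ q / 2 : ℝ) : ℂ)))) := by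
  rw [Metric.tendsto_nhds]
  intro ε hε
  obtain ⟨δ, hδ, hcont⟩ := Metric.continuous_iff.1 Complex.continuous_exp
    (-((q ⬝ᵥ M *ᵥ q / 2 : ℝ) : ℂ)) ε hε
  have hδ4 : 0 < δ / 4 := by positivity
  filter_upwards [eventually_abs_quad_sub_le hI ‖q‖ hδ4,
    eventually_cubic_error_le (m := m) (4 * Fintype.card (Idx m) * (1 + |B|)) ‖q‖ hδ4
      (by positivity)] with n hq hc
  have h1 := hq q le_rfl
  obtain ⟨h2, h3⟩ := hc q le_rfl
  obtain ⟨c, hcs, hcb⟩ := exists_log_charfun_centredStat θ0 (hB n) _ h2 (ζ := Complex.I) (by simp)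
  simp only [mul_comm _ Complex.I, hcs]
  refine hcont c ?_
  set Q := ∑ k, ∑ l, ((√(Ndyads n : ℝ))⁻¹ • q) k * Ifish n m (v n) w g θ0 k l
    * ((√(Ndyads n : ℝ))⁻¹ • q) l with hQ
  have e : c - -((q ⬝ᵥ M *ᵥ q / 2 : ℝ) : ℂ)
      = (c - Complex.I ^ 2 / 2 * (Q : ℂ)) + ((-(Q - q ⬝ᵥ M *ᵥ q) / 2 : ℝ) : ℂ) := by
    rw [Complex.I_sq]
    push_cast
    ring
  rw [dist_eq_norm, e]
  refine (norm_add_le _ _).trans_lt ?_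
  rw [Complex.norm_real, Real.norm_eq_abs, abs_div, abs_neg, abs_two]
  linarith [hcb.trans h3]

theorem exists_eventually_Pr_norm_scaledScore_le
    (hI : Filter.Tendsto (fun n : ℕ => ((Ndyads n : ℝ))⁻¹ • Ifish n m (v n) w g θ0)
      Filter.atTop (nhds M)) {δ : ℝ} (hδ : 0 < δ) :
    ∃ R > 0, ∀ᶠ n : ℕ in Filter.atTop,
      Pr n m (v n) w g θ0 (fun x => R < ‖scaledScore n m (v n) w g θ0 √(Ndyads n : ℝ) x‖) ≤ δ := by
  have hlim : Filter.Tendsto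
      (fun n : ℕ => ∑ k, (√(Ndyads n : ℝ))⁻¹ ^ 2 * Ifish n m (v n) w g θ0 k k)
      Filter.atTop (nhds (∑ k, M k k)) := by
    refine tendsto_finsetSum _ fun k _ => ?_
    have hkk := tendsto_pi_nhds.1 (tendsto_pi_nhds.1 hI k) k
    refine hkk.congr fun n => ?_
    rw [Matrix.smul_apply, smul_eq_mul, inv_pow, Real.sq_sqrt (Nat.cast_nonneg _)]
  set t : ℝ := |∑ k, M k k| + 1 with ht
  have ht0 : 0 < t := by positivity
  refine ⟨√(t / δ), by positivity, ?_⟩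
  filter_upwards [hlim.eventually_le_const
    (show ∑ k, M k k < t by linarith [le_abs_self (∑ k, M k k)])] with n hn
  have h := (Pr_lt_norm_scaledScore_mul_sq_le n m (v n) w g θ0 √(Ndyads n : ℝ)
    (Real.sqrt_nonneg (t / δ))).trans hn
  rw [Real.sq_sqrt (by positivity), ← le_div_iff₀ (by positivity)] at h
  rwa [div_div_cancel₀ ht0.ne'] at h

end Limits

open Matrix in
/-- Localization: the rescaled estimation error is asymptotically equivalent to the solution of
the score equations on the active coordinates. -/
theorem eventually_Pr_estimator_sub_activeSolve_le {m : ℕ} {v : (n : ℕ) → Fin n → Fin m → E}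
    {w : E → E → ℝ} {g : E → ℝ} {θ0 : Idx m → ℝ} {Θ : Set (Idx m → ℝ)}
    {M : Matrix (Idx m) (Idx m) ℝ} (hC1 : CondC1 m v w g θ0 Θ) (hC2 : CondC2 m v w g θ0 M)
    {T : (Idx m → ℝ) →ₗ[ℝ] (Idx m → ℝ)} (hT : ∀ y k, θ0 k ≠ 0 → (M *ᵥ T y) k = y k)
    (hT0 : ∀ y k, ¬ θ0 k ≠ 0 → T y k = 0)
    (hA : ((Finset.univ : Finset (Idx m)).filter fun k => θ0 k ≠ 0).Nonempty)
    (hAc : ((Finset.univ : Finset (Idx m)).filter fun k => θ0 k = 0).Nonempty)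
    {lam : ℕ → ℝ} (hlam : ∀ n, 0 ≤ lam n) {W : (n : ℕ) → (Fin n → Fin n → Bool) → Idx m → ℝ}
    (hW : ∀ n x k, 0 ≤ W n x k)
    (haw : ∀ ε > (0 : ℝ), Filter.Tendsto (fun n : ℕ => Pr n m (v n) w g θ0 (fun x => ε < lam n
      * (((Finset.univ : Finset (Idx m)).filter fun k => θ0 k ≠ 0).sup' hA (W n x))
      / Real.sqrt (Ndyads n))) Filter.atTop (nhds 0))
    (hbw : ∀ R : ℝ, Filter.Tendsto (fun n : ℕ => Pr n m (v n) w g θ0 (fun x => lam n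
      * (((Finset.univ : Finset (Idx m)).filter fun k => θ0 k = 0).inf' hAc (W n x))
      / Real.sqrt (Ndyads n) ≤ R)) Filter.atTop (nhds 0))
    {θhat : (n : ℕ) → (Fin n → Fin n → Bool) → (Idx m → ℝ)}
    (hθhat : ∀ (n : ℕ) (x : Fin n → Fin n → Bool), x ∈ nets n → ∀ θ ∈ Θ,
        -Llik n m (v n) w g (θhat n x) x + lam n * ∑ k, W n x k * |θhat n x k|
          ≤ -Llik n m (v n) w g θ x + lam n * ∑ k, W n x k * |θ k|)
    {ε δ : ℝ} (hε : 0 < ε) (hδ : 0 < δ) :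
    ∀ᶠ n : ℕ in Filter.atTop, Pr n m (v n) w g θ0 (fun x =>
      ε < ‖√(Ndyads n : ℝ) • (θhat n x - θ0)
        - T (scaledScore n m (v n) w g θ0 √(Ndyads n : ℝ) x)‖) ≤ δ := by
  obtain ⟨⟨B, hB⟩, -, -, hint⟩ := hC1
  obtain ⟨hI, hM⟩ := hC2
  have hsymm : M.IsSymm := by
    have := hM.isHermitian
    rwa [IsHermitian, conjTranspose_eq_transpose_of_trivial] at this
  obtain ⟨κ, hκ, hκM⟩ := exists_pos_mul_norm_sq_le hM
  obtain ⟨R, hR, hscore⟩ := exists_eventually_Pr_norm_scaledScore_le hI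
    (show 0 < δ / 3 by positivity)
  set K := ‖LinearMap.toContinuousLinearMap T‖
  have hK : ∀ y, ‖T y‖ ≤ K * ‖y‖ := (LinearMap.toContinuousLinearMap T).le_opNorm
  set K' := ‖LinearMap.toContinuousLinearMap (M.mulVecLin ∘ₗ T)‖
  have hK' : ∀ y, ‖M *ᵥ T y‖ ≤ K' * ‖y‖ :=
    (LinearMap.toContinuousLinearMap (M.mulVecLin ∘ₗ T)).le_opNorm
  have hK0 : 0 ≤ K := norm_nonneg _
  have hK'0 : 0 ≤ K' := norm_nonneg _
  set p : ℝ := (Fintype.card (Idx m) : ℝ) with hp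
  have hp0 : 0 ≤ p := Nat.cast_nonneg _
  set η : ℝ := κ * ε / (8 * (p + 1)) with hη
  have hη0 : 0 < η := by positivity
  set e : ℝ := κ * ε ^ 2 / 16 with he
  have he0 : 0 < e := by positivity
  have hstrict : p * (η * ε) + 2 * e < κ * ε ^ 2 / 2 := by
    have h1 : (p + 1) * (η * ε) = κ * ε ^ 2 / 8 := by rw [hη]; field_simp
    have h2 : 0 < κ * ε ^ 2 := by positivity
    have h3 : 0 < η * ε := by positivity
    rw [he]
    linarith
  obtain ⟨ρ, hρ, hball⟩ := Metric.mem_nhds_iff.1 (mem_interior_iff_mem_nhds.1 hint)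
  have hin : Filter.Tendsto (fun n => (√(Ndyads n : ℝ))⁻¹ * (K * R)) Filter.atTop (nhds 0) := by
    simpa using tendsto_inv_sqrt_Ndyads.mul_const (K * R)
  filter_upwards [hscore, (haw η hη0).eventually_le_const (show 0 < δ / 3 by positivity),
    (hbw (K' * R + R)).eventually_le_const (show 0 < δ / 3 by positivity),
    eventually_abs_localLogZ_sub_le hB hI (K * R + ε) he0, hin.eventually_lt_const hρ,
    eventually_sqrt_Ndyads_pos] with n hn1 hn2 hn3 hquad hnρ hr
  have hsum := add_le_add (add_le_add hn1 hn2) hn3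
  rw [add_thirds] at hsum
  refine (Pr_le_add_three n m (v n) w g θ0 fun x hx hφ => ?_).trans hsum
  by_contra! hnot
  obtain ⟨hs, ha, hb⟩ := hnot
  refine hφ.not_ge ?_
  set r := √(Ndyads n : ℝ) with hrdef
  set y := scaledScore n m (v n) w g θ0 r x with hy
  set uh := r • (θhat n x - θ0) with huh
  have hTy : ‖T y‖ ≤ K * R := (hK y).trans (by gcongr)
  have hMTy : ∀ k, |(M *ᵥ T y) k - y k| ≤ K' * R + R := fun k => by
    refine (abs_sub _ _).trans (add_le_add ?_ ?_)
    · exact (norm_le_pi_norm (M *ᵥ T y) k).trans ((hK' y).trans (by gcongr))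
    · exact (norm_le_pi_norm y k).trans hs
  refine norm_sub_le_of_penalized_min (A := fun k => θ0 k ≠ 0)
    (convexOn_localLogZ n m (v n) w g θ0 r) hsymm hκM (Δ := y)
    (c := fun k => lam n * W n x k / r) (b := fun k => r * θ0 k) hε hη0.le
    (fun u hu => hquad u (hu.trans (by linarith))) (fun k hk => hT y k hk) (fun k hk => hT0 y k hk)
    (fun k (hk : ¬ θ0 k ≠ 0) => by rw [not_not.1 hk, mul_zero])
    (fun k => div_nonneg (mul_nonneg (hlam n) (hW n x k)) hr.le)
    (fun k hk => ?_) (fun k hk => ?_) ?_ hstrict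
  · refine le_trans ?_ ha
    have := Finset.le_sup' (s := Finset.univ.filter fun k => θ0 k ≠ 0) (W n x)
      (Finset.mem_filter.2 ⟨Finset.mem_univ k, hk⟩)
    have hl := hlam n
    gcongr
  · refine (hMTy k).trans (hb.le.trans ?_)
    have := Finset.inf'_le (s := Finset.univ.filter fun k => θ0 k = 0) (W n x)
      (Finset.mem_filter.2 ⟨Finset.mem_univ k, not_not.1 hk⟩)
    have hl := hlam n
    gcongr
  · have hmem : θ0 + r⁻¹ • T y ∈ Θ := hball (by
      rw [Metric.mem_ball, dist_self_add_left, norm_smul, Real.norm_of_nonneg (by positivity)]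
      exact lt_of_le_of_lt (by gcongr) hnρ)
    have hθ : θhat n x = θ0 + r⁻¹ • uh := by
      rw [huh, smul_smul, inv_mul_cancel₀ hr.ne', one_smul, add_sub_cancel]
    have h := hθhat n x hx _ hmem
    rw [hθ, neg_Llik_add_penalty_eq n m (v n) w g θ0 hr, neg_Llik_add_penalty_eq n m (v n) w g θ0 hr]
      at h
    linarith

open Matrix in
/-- The active block of the solution, tested against `t`, is a linear form in the right-hand side
whose coefficient vector `q` satisfies `qᵀ M q = tᵀ M_A⁻¹ t`. -/
theorem exists_dual_activeSolve {ι : Type*} [Fintype ι] {M : Matrix ι ι ℝ} (hM : M.PosDef)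
    {A : ι → Prop} [Fintype {k // A k}] [DecidableEq {k // A k}] {T : (ι → ℝ) →ₗ[ℝ] (ι → ℝ)}
    (hT : ∀ y k, A k → (M *ᵥ T y) k = y k)
    (hT0 : ∀ y k, ¬ A k → T y k = 0)
    (hT1 : ∀ y (k : {k // A k}), T y k
        = ((Matrix.of fun k l : {k // A k} => M k.1 l.1)⁻¹ *ᵥ fun l => y l.1) k)
    (t : {k // A k} → ℝ) :
    ∃ q : ι → ℝ, (∀ y, ∑ k : {k // A k}, T y k * t k = ∑ k, q k * y k) ∧
      q ⬝ᵥ M *ᵥ q = t ⬝ᵥ (Matrix.of fun k l : {k // A k} => M k.1 l.1)⁻¹ *ᵥ t := by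
  set z : ι → ℝ := fun k => if h : A k then t ⟨k, h⟩ else 0 with hz
  have hzt : ∀ k : {k // A k}, z k = t k := fun k => dif_pos k.2
  have hdot : ∀ y z' : ι → ℝ, T y ⬝ᵥ z' = ∑ k : {k // A k}, T y k * z' k := fun y z' =>
    sum_eq_sum_subtype_of_forall_not fun k hk => by rw [hT0 _ _ hk, zero_mul]
  have hsolve : ∀ y z' : ι → ℝ, T y ⬝ᵥ M *ᵥ T z' = T y ⬝ᵥ z' := fun y z' => by
    rw [hdot, hdot]
    exact Finset.sum_congr rfl fun k _ => by rw [hT _ _ k.2]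
  have hsymm : Mᵀ = M := by
    have := hM.isHermitian
    rwa [IsHermitian, conjTranspose_eq_transpose_of_trivial] at this
  refine ⟨T z, fun y => ?_, ?_⟩
  · calc ∑ k : {k // A k}, T y k * t k = T y ⬝ᵥ z := by simp only [hdot, hzt]
      _ = T y ⬝ᵥ M *ᵥ T z := (hsolve y z).symm
      _ = T z ⬝ᵥ M *ᵥ T y := by
        rw [dotProduct_mulVec, ← mulVec_transpose, hsymm, dotProduct_comm]
      _ = T z ⬝ᵥ y := hsolve z y
  · rw [hsolve, hdot]
    simp only [hT1, hzt]
    exact dotProduct_comm _ _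

/-- **Theorem 2, asymptotic normality.** Under conditions (C1) and
(C2), if `a_w/√N → 0` in probability and `b_w/√N → ∞` in probability, then the
active-coordinate block of the regularized maximum likelihood estimator is
asymptotically normal: `√N (θ̂_{N,A} − θ₀,A)` converges in distribution (weak
convergence, tested against bounded continuous functions) to the centered Gaussian
law on `ℝ^{|A|}` with covariance matrix `I_A(θ0)⁻¹`, where `I_A(θ0)` is the `A×A`
submatrix of the limiting normalized Fisher information matrix `I(θ0)`. -/
theorem rmle_asymptotic_normality {E : Type*} (m : ℕ) (hm : 1 ≤ m)
    (v : (n : ℕ) → Fin n → Fin m → E) (w : E → E → ℝ) (g : E → ℝ)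
    (hw : ∀ u u' : E, w u u' = w u' u)
    (θ0 : Idx m → ℝ) (Θ : Set (Idx m → ℝ)) (Imat : Matrix (Idx m) (Idx m) ℝ)
    (hC1 : CondC1 m v w g θ0 Θ) (hC2 : CondC2 m v w g θ0 Imat)
    (hA : ((Finset.univ : Finset (Idx m)).filter fun k => θ0 k ≠ 0).Nonempty)
    (hAc : ((Finset.univ : Finset (Idx m)).filter fun k => θ0 k = 0).Nonempty)
    (lam : ℕ → ℝ) (hlam : ∀ n, 0 ≤ lam n)
    (W : (n : ℕ) → (Fin n → Fin n → Bool) → Idx m → ℝ)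
    (hW : ∀ n x k, 0 ≤ W n x k)
    -- `a_w/√N → 0` in probability, where `a_w = λ_N max_{k ∈ A} w_k`
    (haw : ∀ ε > (0 : ℝ),
      Filter.Tendsto
        (fun n : ℕ => Pr n m (v n) w g θ0
          (fun x => ε < lam n
            * (((Finset.univ : Finset (Idx m)).filter fun k => θ0 k ≠ 0).sup' hA (W n x))
            / Real.sqrt (Ndyads n)))
        Filter.atTop (nhds 0))
    -- `b_w/√N → ∞` in probability, where `b_w = λ_N min_{k ∉ A} w_k`
    (hbw : ∀ M : ℝ,
      Filter.Tendsto
        (fun n : ℕ => Pr n m (v n) w g θ0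
          (fun x => lam n
            * (((Finset.univ : Finset (Idx m)).filter fun k => θ0 k = 0).inf' hAc (W n x))
            / Real.sqrt (Ndyads n) ≤ M))
        Filter.atTop (nhds 0))
    (θhat : (n : ℕ) → (Fin n → Fin n → Bool) → (Idx m → ℝ))
    (hθhat : ∀ (n : ℕ) (x : Fin n → Fin n → Bool), x ∈ nets n →
      θhat n x ∈ Θ ∧ ∀ θ ∈ Θ,
        -Llik n m (v n) w g (θhat n x) x + lam n * ∑ k, W n x k * |θhat n x k|
          ≤ -Llik n m (v n) w g θ x + lam n * ∑ k, W n x k * |θ k|) :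
    ∀ f : BoundedContinuousFunction ({k : Idx m // θ0 k ≠ 0} → ℝ) ℝ,
      Filter.Tendsto
        (fun n : ℕ => ∑ x ∈ nets n,
          f (fun k : {k : Idx m // θ0 k ≠ 0} =>
              Real.sqrt (Ndyads n) * (θhat n x k.1 - θ0 k.1))
            * Pvec n m (v n) w g θ0 x)
        Filter.atTop
        (nhds (∫ u, f u
          ∂(gaussPrec (Matrix.of fun k l : {k : Idx m // θ0 k ≠ 0} => Imat k.1 l.1)))) := by
  obtain ⟨T, hT, hT0, hT1⟩ := exists_activeSolve hC2.2 fun k => θ0 k ≠ 0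
  have hS : (Matrix.of fun k l : {k : Idx m // θ0 k ≠ 0} => Imat k.1 l.1).PosDef :=
    hC2.2.submatrix Subtype.val_injective
  obtain ⟨B, hB⟩ := hC1.1
  refine tendsto_gaussPrec_of_charFun hS nets (fun n => Pvec n m (v n) w g θ0)
    (fun n => Pvec_nonneg n m (v n) w g θ0) (fun n => sum_Pvec n m (v n) w g θ0) _ fun t => ?_
  obtain ⟨q, hq, hqq⟩ := exists_dual_activeSolve hC2.2 hT hT0 hT1 t
  have hlim := tendsto_charFun_centredStat hB hC2.1 q
  rw [hqq] at hlim
  have hstat : ∀ n x, centredStat n m (v n) w g θ0 ((√(Ndyads n : ℝ))⁻¹ • q) x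
      = ∑ k : {k // θ0 k ≠ 0}, T (scaledScore n m (v n) w g θ0 √(Ndyads n : ℝ) x) k * t k :=
    fun n x => by
      rw [hq]
      exact Finset.sum_congr rfl fun k _ => by
        simp only [scaledScore, Pi.smul_apply, smul_eq_mul]; ring
  simp only [hstat] at hlim
  rw [Metric.tendsto_nhds] at hlim ⊢
  intro ε hε
  set K := ∑ k, |t k| with hK
  have hK0 : 0 ≤ K := Finset.sum_nonneg fun k _ => abs_nonneg _
  have hε' : 0 < ε / (4 * (K + 1)) := by positivity
  filter_upwards [eventually_Pr_estimator_sub_activeSolve_le hC1 hC2 hT hT0 hA hAc hlam hW haw hbw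
    (fun n x hx => (hθhat n x hx).2) hε' (show 0 < ε / 16 by positivity),
    hlim (ε / 2) (half_pos hε)] with n hn hnlim
  refine (dist_triangle _ _ _).trans_lt ((add_lt_add_of_le_of_lt ?_ hnlim).trans_eq (add_halves ε))
  rw [dist_eq_norm]
  refine (norm_sum_Pvec_mul_cexp_sub_le n m (v n) w g θ0
    (φ := fun x => ε / (4 * (K + 1)) < ‖√(Ndyads n : ℝ) • (θhat n x - θ0)
      - T (scaledScore n m (v n) w g θ0 √(Ndyads n : ℝ) x)‖)
    (show 0 ≤ ε / (4 * (K + 1)) * K by positivity) fun x _ hx => ?_).trans ?_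
  · rw [← Finset.sum_sub_distrib, hK, Finset.mul_sum]
    refine (Finset.abs_sum_le_sum_abs _ _).trans (Finset.sum_le_sum fun k _ => ?_)
    rw [← sub_mul, abs_mul]
    refine mul_le_mul_of_nonneg_right ?_ (abs_nonneg _)
    exact (norm_le_pi_norm _ k.1).trans (not_lt.1 hx)
  · have h1 : ε / (4 * (K + 1)) * K ≤ ε / 4 := by
      rw [div_mul_eq_mul_div, div_le_div_iff₀ (by positivity) (by norm_num)]
      nlinarith
    linarith
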